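/- arXiv:2410.05832 — 5 statements merged into one kernel-verified Lean document; each statement's English description precedes it below -/
import Mathlib

section
/- One-point extension property for partial isomorphisms of M_{C,lev}: let n ∈ ℕ, let a₁,…,aₙ ∈ M be distinct, let b₁,…,bₙ ∈ M be distinct, and suppose the map aᵢ ↦ bᵢ is a partial isomorphism. Then for every a ∈ M \ {a₁,…,aₙ} there exists b ∈ M \ {b₁,…,bₙ} such that the map sending aᵢ ↦ bᵢ (for 1 ≤ i ≤ n) and a ↦ b is again a partial isomorphism. -/
/-- The domain of `M_{C,lev}`: finitely supported functions `ℚ → ℕ`. -/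
abbrev MClev : Type := ℚ →₀ ℕ

/-- For `a ≠ b`, the minimum of the (finite nonempty) set `{i : ℚ | a i ≠ b i}`,
computed in `WithTop ℚ` (it is `⊤` iff `a = b`). -/
def meet (a b : MClev) : WithTop ℚ :=
  ((a.support ∪ b.support).filter (fun i => a i ≠ b i)).min

/-- The ternary relation `C(a; b, c)` on `M_{C,lev}`. -/
def Crel (a b c : MClev) : Prop :=
  (b = c ∧ a ≠ b) ∨ (a ≠ b ∧ a ≠ c ∧ b ≠ c ∧ meet a b < meet b c)

/-- The quaternary relation `V(a, b; c, d)` on `M_{C,lev}`. -/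
def Vrel (a b c d : MClev) : Prop :=
  a ≠ b ∧ c ≠ d ∧ meet a b ≤ meet c d

/-- An automorphism of `(M, C, V)`. -/
def IsAut (g : MClev → MClev) : Prop :=
  Function.Bijective g ∧
  (∀ a b c : MClev, Crel a b c ↔ Crel (g a) (g b) (g c)) ∧
  (∀ a b c d : MClev, Vrel a b c d ↔ Vrel (g a) (g b) (g c) (g d))

/-- A partial isomorphism with domain `A`. -/
def IsPartialIso (A : Set MClev) (f : MClev → MClev) : Prop :=
  Set.InjOn f A ∧
  (∀ a ∈ A, ∀ b ∈ A, ∀ c ∈ A, (Crel a b c ↔ Crel (f a) (f b) (f c))) ∧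
  (∀ a ∈ A, ∀ b ∈ A, ∀ c ∈ A, ∀ d ∈ A,
    (Vrel a b c d ↔ Vrel (f a) (f b) (f c) (f d)))

theorem le_meet_iff {a b : MClev} {c : WithTop ℚ} :
    c ≤ meet a b ↔ ∀ i : ℚ, (i : WithTop ℚ) < c → a i = b i := by
  unfold meet
  rw [Finset.le_min_iff]
  constructor
  · intro h i hi
    by_contra hne
    refine absurd (h i ?_) (not_le.2 hi)
    simp only [Finset.mem_filter, Finset.mem_union, Finsupp.mem_support_iff]
    refine ⟨?_, hne⟩
    by_contra! h0
    exact hne (h0.1.trans h0.2.symm)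
  · intro h i hi
    by_contra hlt
    exact (Finset.mem_filter.1 hi).2 (h i (not_le.1 hlt))

theorem meet_comm (a b : MClev) : meet a b = meet b a :=
  eq_of_forall_le_iff fun c => by simp only [le_meet_iff, eq_comm]

theorem min_meet_le (a b c : MClev) : min (meet a b) (meet b c) ≤ meet a c :=
  le_meet_iff.2 fun i hi =>
    (le_meet_iff.1 le_rfl i (lt_min_iff.1 hi).1).trans (le_meet_iff.1 le_rfl i (lt_min_iff.1 hi).2)

theorem meet_eq_top_iff {a b : MClev} : meet a b = ⊤ ↔ a = b := by
  rw [← top_le_iff, le_meet_iff]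
  exact ⟨fun h => Finsupp.ext fun i => h i (WithTop.coe_lt_top i), fun h i _ => by rw [h]⟩

/-- If `a i₀` is as close as possible to `x`, every distance from `x` is computed through `a i₀`. -/
theorem meet_eq_min_of_forall_le {x u v : MClev} (h : meet x v ≤ meet x u) :
    meet x v = min (meet x u) (meet u v) := by
  refine le_antisymm (le_min h ?_) (min_meet_le x u v)
  have := min_meet_le u x v
  rwa [meet_comm u x, min_eq_right h] at this

/-- One can branch off from `u` at level `q`, avoiding finitely many given points. -/
theorem exists_meet_eq_min {ι : Type*} [Finite ι] (b : ι → MClev) (u : MClev) (q : ℚ) :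
    ∃ y : MClev, ∀ j, meet y (b j) = min (q : WithTop ℚ) (meet u (b j)) := by
  obtain ⟨N, hN⟩ := (Set.finite_range fun j => b j q).exists_notMem
  refine ⟨(u.filter (· < q)).update q N, fun j => eq_of_forall_le_iff fun c => ?_⟩
  have hlow : ∀ i < q, (u.filter (· < q)).update q N i = u i := fun i hi => by
    simp [Finsupp.update_apply, hi.ne, hi]
  rw [le_min_iff, le_meet_iff, le_meet_iff]
  constructor
  · intro h
    have hc : c ≤ q := by
      by_contra hlt
      exact hN ⟨j, by simpa using (h q (not_le.1 hlt)).symm⟩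
    exact ⟨hc, fun i hi => (hlow i (WithTop.coe_lt_coe.1 (hi.trans_le hc))).symm.trans (h i hi)⟩
  · rintro ⟨hc, h⟩ i hi
    exact (hlow i (WithTop.coe_lt_coe.1 (hi.trans_le hc))).trans (h i hi)

/-- A finite partial order isomorphism of `WithTop ℚ` fixing `⊤` extends to any rational. -/
theorem exists_rat_same_cut {ι : Type*} [Finite ι] (s t : ι → WithTop ℚ)
    (htop : ∀ i, s i = ⊤ ↔ t i = ⊤) (hle : ∀ i j, s i ≤ s j ↔ t i ≤ t j) (m : ℚ) :
    ∃ q : ℚ, ∀ i, (s i ≤ m ↔ t i ≤ q) ∧ ((m : WithTop ℚ) ≤ s i ↔ (q : WithTop ℚ) ≤ t i) := by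
  have hfin : {p : ℚ × ℚ | ∃ i, s i = p.1 ∧ t i = p.2}.Finite := by
    refine (Set.finite_range fun i => ((s i).untopD 0, (t i).untopD 0)).subset ?_
    rintro ⟨u, v⟩ ⟨i, hs, ht⟩
    exact ⟨i, by simp [hs, ht]⟩
  let f : Order.PartialIso ℚ ℚ := ⟨hfin.toFinset, by
    intro p hp p' hp'
    obtain ⟨i, hs, ht⟩ := hfin.mem_toFinset.1 hp
    obtain ⟨j, hs', ht'⟩ := hfin.mem_toFinset.1 hp'
    have h₁ := hle i j
    have h₂ := hle j i
    simp only [hs, ht, hs', ht', WithTop.coe_le_coe] at h₁ h₂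
    exact cmp_eq_cmp_symm.1 (by grind [cmp, cmpUsing])⟩
  obtain ⟨q, hq⟩ := Order.PartialIso.exists_across f m
  refine ⟨q, fun i => ?_⟩
  by_cases hi : s i = ⊤
  · simp [hi, (htop i).1 hi]
  · obtain ⟨u, hu⟩ := WithTop.ne_top_iff_exists.1 hi
    obtain ⟨v, hv⟩ := WithTop.ne_top_iff_exists.1 (mt (htop i).2 hi)
    have h := hq (u, v) (hfin.mem_toFinset.2 ⟨i, hu.symm, hv.symm⟩)
    rw [← hu, ← hv]
    simp only [WithTop.coe_le_coe]
    exact ⟨le_iff_le_of_cmp_eq_cmp h, le_iff_le_of_cmp_eq_cmp (cmp_eq_cmp_symm.1 h)⟩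

theorem Vrel_iff_of_meet_le_iff {ι : Type*} {a b : ι → MClev}
    (ha : Function.Injective a) (hb : Function.Injective b)
    (h : ∀ i j k l, meet (a i) (a j) ≤ meet (a k) (a l) ↔ meet (b i) (b j) ≤ meet (b k) (b l))
    (i j k l : ι) :
    Vrel (a i) (a j) (a k) (a l) ↔ Vrel (b i) (b j) (b k) (b l) := by
  simp only [Vrel, ha.ne_iff, hb.ne_iff, h]

theorem Crel_iff_of_meet_le_iff {ι : Type*} {a b : ι → MClev}
    (ha : Function.Injective a) (hb : Function.Injective b)
    (h : ∀ i j k l, meet (a i) (a j) ≤ meet (a k) (a l) ↔ meet (b i) (b j) ≤ meet (b k) (b l))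
    (i j k : ι) :
    Crel (a i) (a j) (a k) ↔ Crel (b i) (b j) (b k) := by
  simp only [Crel, ha.ne_iff, hb.ne_iff, ha.eq_iff, hb.eq_iff, ← not_le, h]

theorem meet_le_iff_of_Vrel_iff {ι : Type*} {a b : ι → MClev}
    (ha : Function.Injective a) (hb : Function.Injective b)
    (hV : ∀ i j k l, Vrel (a i) (a j) (a k) (a l) ↔ Vrel (b i) (b j) (b k) (b l))
    (i j k l : ι) :
    meet (a i) (a j) ≤ meet (a k) (a l) ↔ meet (b i) (b j) ≤ meet (b k) (b l) := by
  by_cases hkl : k = l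
  · simp [hkl, meet_eq_top_iff.2]
  by_cases hij : i = j
  · simp [hij, meet_eq_top_iff.2, meet_eq_top_iff, ha.eq_iff, hb.eq_iff]
  · simpa [Vrel, ha.eq_iff, hb.eq_iff, hij, hkl] using hV i j k l

/-- The extension property phrased through the order on pairwise meets. -/
theorem exists_extend_meet_le_iff {n : ℕ} [NeZero n] {a b : Fin n → MClev}
    (ha : Function.Injective a) (hb : Function.Injective b)
    (h : ∀ i j k l, meet (a i) (a j) ≤ meet (a k) (a l) ↔ meet (b i) (b j) ≤ meet (b k) (b l))
    {x : MClev} (hx : x ∉ Set.range a) :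
    ∃ y : MClev, y ∉ Set.range b ∧ ∀ i j k l : Fin (n + 1),
      meet ((Fin.snoc a x : Fin (n + 1) → MClev) i) ((Fin.snoc a x : Fin (n + 1) → MClev) j) ≤
        meet ((Fin.snoc a x : Fin (n + 1) → MClev) k) ((Fin.snoc a x : Fin (n + 1) → MClev) l) ↔
      meet ((Fin.snoc b y : Fin (n + 1) → MClev) i) ((Fin.snoc b y : Fin (n + 1) → MClev) j) ≤
        meet ((Fin.snoc b y : Fin (n + 1) → MClev) k)
          ((Fin.snoc b y : Fin (n + 1) → MClev) l) := by
  obtain ⟨i₀, hi₀⟩ := Finite.exists_max fun i => meet x (a i)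
  obtain ⟨m, hm⟩ := WithTop.ne_top_iff_exists.1
    (mt meet_eq_top_iff.1 fun he : x = a i₀ => hx ⟨i₀, he.symm⟩)
  obtain ⟨q, hq⟩ := exists_rat_same_cut
    (fun p : Fin n × Fin n => meet (a p.1) (a p.2)) (fun p => meet (b p.1) (b p.2))
    (fun p => by simp only [meet_eq_top_iff, ha.eq_iff, hb.eq_iff])
    (fun p p' => h p.1 p.2 p'.1 p'.2) m
  obtain ⟨y, hy⟩ := exists_meet_eq_min b (b i₀) q
  have hxa : ∀ j, meet x (a j) = min (m : WithTop ℚ) (meet (a i₀) (a j)) := fun j => by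
    rw [hm]; exact meet_eq_min_of_forall_le (hi₀ j)
  let P : WithTop ℚ → WithTop ℚ → Prop := fun s t =>
    (s = m ∧ t = q) ∨ ∃ i j, s = meet (a i) (a j) ∧ t = meet (b i) (b j)
  have hP : ∀ {s t s' t'}, P s t → P s' t' → (s ≤ s' ↔ t ≤ t') := by
    rintro _ _ _ _ (⟨rfl, rfl⟩ | ⟨i, j, rfl, rfl⟩) (⟨rfl, rfl⟩ | ⟨k, l, rfl, rfl⟩)
    · simp
    · exact (hq (k, l)).2
    · exact (hq (i, j)).1
    · exact h i j k l
  have hPx : ∀ j, P (meet x (a j)) (meet y (b j)) := fun j => by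
    rw [hxa, hy]
    rcases le_total (m : WithTop ℚ) (meet (a i₀) (a j)) with hle | hle
    · rw [min_eq_left hle, min_eq_left ((hq (i₀, j)).2.1 hle)]
      exact Or.inl ⟨rfl, rfl⟩
    · rw [min_eq_right hle, min_eq_right ((hq (i₀, j)).1.1 hle)]
      exact Or.inr ⟨i₀, j, rfl, rfl⟩
  have hPmeet : ∀ i j : Fin (n + 1),
      P (meet ((Fin.snoc a x : Fin (n + 1) → MClev) i) ((Fin.snoc a x : Fin (n + 1) → MClev) j))
        (meet ((Fin.snoc b y : Fin (n + 1) → MClev) i)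
          ((Fin.snoc b y : Fin (n + 1) → MClev) j)) := by
    intro i j
    induction i using Fin.lastCases with
    | last =>
      induction j using Fin.lastCases with
      | last =>
        refine Or.inr ⟨i₀, i₀, ?_, ?_⟩ <;> rw [meet_eq_top_iff.2 rfl, meet_eq_top_iff.2 rfl]
      | cast j => simpa only [Fin.snoc_last, Fin.snoc_castSucc] using hPx j
    | cast i =>
      induction j using Fin.lastCases with
      | last =>
        simpa only [Fin.snoc_last, Fin.snoc_castSucc, meet_comm _ x, meet_comm _ y] using hPx i
      | cast j =>
        simp only [Fin.snoc_castSucc]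
        exact Or.inr ⟨i, j, rfl, rfl⟩
  refine ⟨y, ?_, fun i j k l => hP (hPmeet i j) (hPmeet k l)⟩
  rintro ⟨j, hj⟩
  have := (hy j).symm.trans (meet_eq_top_iff.2 hj.symm)
  exact WithTop.coe_ne_top (min_eq_top.1 this).1

/-- one-point extension property for partial isomorphisms of
`M_{C,lev}`.  If `a₁,…,aₙ ↦ b₁,…,bₙ` is a partial isomorphism and
`x ∉ {a₁,…,aₙ}`, then there is `y ∉ {b₁,…,bₙ}` such that the extended map
(sending also `x ↦ y`) is again a partial isomorphism. -/
theorem one_point_extension (n : ℕ) (a b : Fin n → MClev)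
    (ha : Function.Injective a) (hb : Function.Injective b)
    (hC : ∀ i j k : Fin n, Crel (a i) (a j) (a k) ↔ Crel (b i) (b j) (b k))
    (hV : ∀ i j k l : Fin n,
      Vrel (a i) (a j) (a k) (a l) ↔ Vrel (b i) (b j) (b k) (b l))
    (x : MClev) (hx : x ∉ Set.range a) :
    ∃ y : MClev, y ∉ Set.range b ∧
      (∀ i j k : Fin (n + 1),
        Crel ((Fin.snoc a x : Fin (n + 1) → MClev) i)
             ((Fin.snoc a x : Fin (n + 1) → MClev) j)
             ((Fin.snoc a x : Fin (n + 1) → MClev) k) ↔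
        Crel ((Fin.snoc b y : Fin (n + 1) → MClev) i)
             ((Fin.snoc b y : Fin (n + 1) → MClev) j)
             ((Fin.snoc b y : Fin (n + 1) → MClev) k)) ∧
      (∀ i j k l : Fin (n + 1),
        Vrel ((Fin.snoc a x : Fin (n + 1) → MClev) i)
             ((Fin.snoc a x : Fin (n + 1) → MClev) j)
             ((Fin.snoc a x : Fin (n + 1) → MClev) k)
             ((Fin.snoc a x : Fin (n + 1) → MClev) l) ↔
        Vrel ((Fin.snoc b y : Fin (n + 1) → MClev) i)
             ((Fin.snoc b y : Fin (n + 1) → MClev) j)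
             ((Fin.snoc b y : Fin (n + 1) → MClev) k)
             ((Fin.snoc b y : Fin (n + 1) → MClev) l)) := by
  rcases n.eq_zero_or_pos with rfl | hn
  · obtain rfl : a = b := Subsingleton.elim a b
    exact ⟨x, hx, fun _ _ _ => Iff.rfl, fun _ _ _ _ => Iff.rfl⟩
  · have : NeZero n := ⟨hn.ne'⟩
    obtain ⟨y, hy, h⟩ :=
      exists_extend_meet_le_iff ha hb (meet_le_iff_of_Vrel_iff ha hb hV) hx
    have ha' := Fin.snoc_injective_of_injective ha hx
    have hb' := Fin.snoc_injective_of_injective hb hy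
    exact ⟨y, hy, Crel_iff_of_meet_le_iff ha' hb' h, Vrel_iff_of_meet_le_iff ha' hb' h⟩
end

section
/- Permutation patterns are faithfully encoded in M_{C,lev}: there is an assignment to every n ≥ 2 and every permutation pattern σ of size n of a σ-configuration C_σ in M (with underlying set of size 2n + 3) such that for all patterns σ of size m ≥ 2 and τ of size n ≥ 2, if there exists a partial isomorphism from the underlying set of C_σ into the underlying set of C_τ (an injective map preserving C and V and their negations), then σ embeds into τ. -/
/-- A σ-configuration in `M_{C,lev}` for a permutation pattern
`σ = (lt1, lt2)` of size `n`: pairwise distinct elements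
`a¹, a², a³, b₁, …, bₙ, c₁, …, cₙ` satisfying conditions (1)–(4). -/
def IsConfig {n : ℕ} (lt1 lt2 : Fin n → Fin n → Prop)
    (a : Fin 3 → MClev) (b c : Fin n → MClev) : Prop :=
  (Function.Injective a ∧ Function.Injective b ∧ Function.Injective c ∧
    (∀ (i : Fin 3) (j : Fin n), a i ≠ b j) ∧
    (∀ (i : Fin 3) (j : Fin n), a i ≠ c j) ∧
    (∀ i j : Fin n, b i ≠ c j)) ∧
  (∀ i j k : Fin 3, i ≠ j → i ≠ k → j ≠ k → ¬ Crel (a i) (a j) (a k)) ∧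
  (∀ (j : Fin 3) (i : Fin n), Crel (a j) (b i) (c i)) ∧
  (∀ (k : Fin 3) (i j : Fin n), lt1 i j → meet (a k) (b i) < meet (a k) (b j)) ∧
  (∀ i j : Fin n, lt2 i j → meet (b i) (c i) < meet (b j) (c j))

/-- The underlying set of a configuration. -/
def configSet {n : ℕ} (a : Fin 3 → MClev) (b c : Fin n → MClev) : Set MClev :=
  Set.range a ∪ Set.range b ∪ Set.range c

theorem eq_of_lt_meet {x y : MClev} {i : ℚ} (h : (i : WithTop ℚ) < meet x y) : x i = y i := by
  by_contra hne
  refine absurd (Finset.min_le (a := i) ?_) (not_le.2 h)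
  simp only [Finset.mem_filter, Finset.mem_union, Finsupp.mem_support_iff]
  exact ⟨by by_contra! h0; exact hne (h0.1.trans h0.2.symm), hne⟩

theorem exists_meet_eq {x y : MClev} (h : x ≠ y) :
    ∃ q : ℚ, meet x y = q ∧ x q ≠ y q ∧ ∀ i < q, x i = y i := by
  obtain ⟨i, hi⟩ := Finsupp.ne_iff.1 h
  have hmem : i ∈ (x.support ∪ y.support).filter (fun i => x i ≠ y i) := by
    simp only [Finset.mem_filter, Finset.mem_union, Finsupp.mem_support_iff]
    exact ⟨by by_contra! h0; exact hi (h0.1.trans h0.2.symm), hi⟩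
  obtain ⟨q, hq⟩ := Finset.min_of_mem hmem
  refine ⟨q, hq, (Finset.mem_filter.1 (Finset.mem_of_min hq)).2, fun j hj => ?_⟩
  refine eq_of_lt_meet (lt_of_lt_of_eq (WithTop.coe_lt_coe.2 hj) hq.symm)

theorem meet_eq_coe {x y : MClev} {q : ℚ} (hq : x q ≠ y q) (hlt : ∀ i < q, x i = y i) :
    meet x y = q := by
  obtain ⟨r, hr, hne, hr'⟩ := exists_meet_eq (x := x) (y := y) (fun h => hq (by rw [h]))
  rcases lt_trichotomy r q with h | h | h
  · exact absurd (hlt r h) hne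
  · rw [hr, h]
  · exact absurd (hr' q h) hq

theorem meet_comm_s6 (x y : MClev) : meet x y = meet y x := by
  simp only [meet, Finset.union_comm x.support, ne_comm]

open Classical in
/-- The number of predecessors of `i` under a relation on `Fin n`. -/
noncomputable def rank {n : ℕ} (lt : Fin n → Fin n → Prop) (i : Fin n) : ℕ :=
  (Finset.univ.filter fun j => lt j i).card

section Rank

variable {n : ℕ} {lt : Fin n → Fin n → Prop}

theorem rank_lt_rank (h : IsStrictTotalOrder (Fin n) lt) {i j : Fin n} (hij : lt i j) :
    rank lt i < rank lt j := by
  classical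
  refine Finset.card_lt_card (Finset.ssubset_iff_of_subset ?_ |>.2 ⟨i, ?_, ?_⟩)
  · intro k hk
    simp only [Finset.mem_filter, Finset.mem_univ, true_and] at hk ⊢
    exact _root_.trans_of lt hk hij
  · simpa using hij
  · simpa using irrefl_of lt i

theorem lt_of_rank_lt_rank (h : IsStrictTotalOrder (Fin n) lt) {i j : Fin n}
    (hij : rank lt i < rank lt j) : lt i j := by
  rcases trichotomous_of lt i j with h' | rfl | h'
  · exact h'
  · exact absurd hij (lt_irrefl _)
  · exact absurd (rank_lt_rank h h') hij.asymm

theorem rank_injective (h : IsStrictTotalOrder (Fin n) lt) : Function.Injective (rank lt) := by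
  intro i j hij
  rcases trichotomous_of lt i j with h' | h' | h'
  · exact absurd hij (rank_lt_rank h h').ne
  · exact h'
  · exact absurd hij (rank_lt_rank h h').ne'

theorem rank_lt (h : IsStrictTotalOrder (Fin n) lt) (i : Fin n) : rank lt i < n := by
  classical
  have : rank lt i < (Finset.univ : Finset (Fin n)).card :=
    Finset.card_lt_card ((Finset.ssubset_iff_of_subset (Finset.subset_univ _)).2
      ⟨i, Finset.mem_univ i, by simpa using irrefl_of lt i⟩)
  simpa using this

end Rank

/-- Three points branching simultaneously from the zero branch at level `n`. -/
noncomputable def tripod (n : ℕ) (k : Fin 3) : MClev := Finsupp.single (n : ℚ) (k : ℕ)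

/-- The point leaving the zero branch at the level given by the first order. -/
noncomputable def stem {n : ℕ} (lt : Fin n → Fin n → Prop) (i : Fin n) : MClev :=
  Finsupp.single (rank lt i : ℚ) 1

/-- The point leaving `stem lt₁ i` at the level given by the second order. -/
noncomputable def twig {n : ℕ} (lt₁ lt₂ : Fin n → Fin n → Prop) (i : Fin n) : MClev :=
  stem lt₁ i + Finsupp.single ((n + 1 + rank lt₂ i : ℕ) : ℚ) 1

section Configuration

variable {n : ℕ} {lt₁ lt₂ : Fin n → Fin n → Prop}

theorem meet_stem_twig (i : Fin n) :
    meet (stem lt₁ i) (twig lt₁ lt₂ i) = ((n + 1 + rank lt₂ i : ℕ) : ℚ) := by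
  refine meet_eq_coe (by simp [twig]) fun q hq => ?_
  rw [twig, Finsupp.add_apply, Finsupp.single_eq_of_ne hq.ne, add_zero]

theorem branch_apply_of_le {x : MClev} {i : Fin n}
    (hx : x = stem lt₁ i ∨ x = twig lt₁ lt₂ i) {q : ℚ} (hq : q ≤ n) :
    x q = if (rank lt₁ i : ℚ) = q then 1 else 0 := by
  have h : ((n + 1 + rank lt₂ i : ℕ) : ℚ) ≠ q := by
    refine (lt_of_le_of_lt hq ?_).ne'
    exact_mod_cast (by omega : n < n + 1 + rank lt₂ i)
  rcases hx with rfl | rfl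
  · simp [stem, Finsupp.single_apply]
  · rw [twig, Finsupp.add_apply, Finsupp.single_eq_of_ne' h]
    simp [stem, Finsupp.single_apply]

theorem branch_apply_le_one (h₁ : IsStrictTotalOrder (Fin n) lt₁) {x : MClev} {i : Fin n}
    (hx : x = stem lt₁ i ∨ x = twig lt₁ lt₂ i) (q : ℚ) : x q ≤ 1 := by
  rcases le_or_gt q n with hq | hq
  · rw [branch_apply_of_le hx hq]; split_ifs <;> simp
  · have hr : (rank lt₁ i : ℚ) ≠ q := by
      refine (lt_trans ?_ hq).ne
      exact_mod_cast rank_lt h₁ i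
    rcases hx with rfl | rfl
    · simp [stem, Finsupp.single_eq_of_ne' hr]
    · rw [twig, stem, Finsupp.add_apply, Finsupp.single_eq_of_ne' hr, Finsupp.single_apply]
      split_ifs <;> simp

theorem branch_apply_rank (h₁ : IsStrictTotalOrder (Fin n) lt₁) {x : MClev} {i j : Fin n}
    (hx : x = stem lt₁ i ∨ x = twig lt₁ lt₂ i) :
    x (rank lt₁ j : ℚ) = if i = j then 1 else 0 := by
  rw [branch_apply_of_le hx (by exact_mod_cast (rank_lt h₁ j).le)]
  simp [(rank_injective h₁).eq_iff]

theorem branch_apply_top (h₁ : IsStrictTotalOrder (Fin n) lt₁) {x : MClev} {i : Fin n}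
    (hx : x = stem lt₁ i ∨ x = twig lt₁ lt₂ i) : x (n : ℚ) = 0 := by
  rw [branch_apply_of_le hx le_rfl, if_neg]
  exact_mod_cast (rank_lt h₁ i).ne

theorem tripod_apply_of_ne (k : Fin 3) {q : ℚ} (hq : q ≠ n) : tripod n k q = 0 :=
  Finsupp.single_eq_of_ne hq

theorem tripod_apply_rank (h₁ : IsStrictTotalOrder (Fin n) lt₁) (k : Fin 3) (i : Fin n) :
    tripod n k (rank lt₁ i : ℚ) = 0 :=
  tripod_apply_of_ne k (by exact_mod_cast (rank_lt h₁ i).ne)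

theorem tripod_ne_branch (h₁ : IsStrictTotalOrder (Fin n) lt₁) {x : MClev} {i : Fin n}
    (hx : x = stem lt₁ i ∨ x = twig lt₁ lt₂ i) (k : Fin 3) : tripod n k ≠ x := by
  rintro rfl
  have := branch_apply_rank h₁ (j := i) hx
  simp [tripod_apply_rank h₁] at this

theorem tripod_injective (n : ℕ) : Function.Injective (tripod n) := fun _ _ h =>
  Fin.ext (Finsupp.single_injective (n : ℚ) h)

theorem meet_tripod (n : ℕ) {k l : Fin 3} (h : k ≠ l) : meet (tripod n k) (tripod n l) = (n : ℚ) :=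
  meet_eq_coe (by simpa [tripod, Fin.ext_iff] using h)
    fun q hq => by simp only [tripod_apply_of_ne _ hq.ne]

theorem meet_tripod_branch (h₁ : IsStrictTotalOrder (Fin n) lt₁) {x : MClev} {i : Fin n}
    (hx : x = stem lt₁ i ∨ x = twig lt₁ lt₂ i) (k : Fin 3) :
    meet (tripod n k) x = (rank lt₁ i : ℚ) := by
  have hr : (rank lt₁ i : ℚ) < n := by exact_mod_cast rank_lt h₁ i
  refine meet_eq_coe ?_ fun q hq => ?_
  · rw [tripod_apply_rank h₁, branch_apply_rank h₁ hx]; simp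
  · rw [tripod_apply_of_ne k (hq.trans hr).ne, branch_apply_of_le hx (hq.trans hr).le,
      if_neg hq.ne']

theorem meet_branch_self {x y : MClev} {i : Fin n}
    (hx : x = stem lt₁ i ∨ x = twig lt₁ lt₂ i) (hy : y = stem lt₁ i ∨ y = twig lt₁ lt₂ i)
    (hxy : x ≠ y) : meet x y = ((n + 1 + rank lt₂ i : ℕ) : ℚ) := by
  rcases hx with rfl | rfl <;> rcases hy with rfl | rfl
  · exact absurd rfl hxy
  · exact meet_stem_twig i
  · rw [meet_comm_s6]; exact meet_stem_twig i
  · exact absurd rfl hxy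

theorem branch_index_unique (h₁ : IsStrictTotalOrder (Fin n) lt₁) {x : MClev} {i j : Fin n}
    (hi : x = stem lt₁ i ∨ x = twig lt₁ lt₂ i) (hj : x = stem lt₁ j ∨ x = twig lt₁ lt₂ j) :
    i = j := by
  have h := (branch_apply_rank h₁ (j := i) hi).symm.trans (branch_apply_rank h₁ (j := i) hj)
  by_contra hne
  simp [Ne.symm hne] at h

theorem mem_configSet_iff {x : MClev} :
    x ∈ configSet (tripod n) (stem lt₁) (twig lt₁ lt₂) ↔
      (∃ k, x = tripod n k) ∨ ∃ i, x = stem lt₁ i ∨ x = twig lt₁ lt₂ i := by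
  simp only [configSet, Set.mem_union, Set.mem_range, eq_comm (b := x), exists_or, or_assoc]

theorem isConfig_tripod_stem_twig (h₁ : IsStrictTotalOrder (Fin n) lt₁)
    (h₂ : IsStrictTotalOrder (Fin n) lt₂) :
    IsConfig lt₁ lt₂ (tripod n) (stem lt₁) (twig lt₁ lt₂) := by
  have hb (i : Fin n) : stem lt₁ i = stem lt₁ i ∨ stem lt₁ i = twig lt₁ lt₂ i := Or.inl rfl
  have hc (i : Fin n) : twig lt₁ lt₂ i = stem lt₁ i ∨ twig lt₁ lt₂ i = twig lt₁ lt₂ i :=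
    Or.inr rfl
  have hbc (i j : Fin n) : stem lt₁ i ≠ twig lt₁ lt₂ j := by
    intro h
    obtain rfl : i = j := branch_index_unique (lt₂ := lt₂) h₁ (hb i) (Or.inr h)
    have := DFunLike.congr_fun h ((n + 1 + rank lt₂ i : ℕ) : ℚ)
    simp [twig] at this
  refine ⟨⟨tripod_injective n, fun i j h => branch_index_unique (lt₂ := lt₂) h₁ (hb i) (Or.inl h),
    fun i j h => branch_index_unique h₁ (hc i) (Or.inr h), fun k i => tripod_ne_branch h₁ (hb i) k,
    fun k i => tripod_ne_branch h₁ (hc i) k, hbc⟩, ?_, ?_, ?_, ?_⟩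
  · rintro i j k hij hik hjk (⟨h, -⟩ | ⟨-, -, -, h⟩)
    · exact hjk (tripod_injective n h)
    · rw [meet_tripod n hij, meet_tripod n hjk] at h
      exact lt_irrefl _ h
  · intro k i
    refine Or.inr ⟨tripod_ne_branch h₁ (hb i) k, tripod_ne_branch h₁ (hc i) k, hbc i i, ?_⟩
    rw [meet_tripod_branch h₁ (hb i), meet_stem_twig, WithTop.coe_lt_coe, Nat.cast_lt]
    have := rank_lt h₁ i
    omega
  · intro k i j hij
    rw [meet_tripod_branch h₁ (hb i), meet_tripod_branch h₁ (hb j), WithTop.coe_lt_coe,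
      Nat.cast_lt]
    exact rank_lt_rank h₁ hij
  · intro i j hij
    rw [meet_stem_twig, meet_stem_twig, WithTop.coe_lt_coe, Nat.cast_lt]
    have := rank_lt_rank h₂ hij
    omega

/-- The tripod is the only place where three points of the configuration branch at once. -/
theorem eq_tripod_of_not_Crel (h₁ : IsStrictTotalOrder (Fin n) lt₁) {x : Fin 3 → MClev}
    (hmem : ∀ k, x k ∈ configSet (tripod n) (stem lt₁) (twig lt₁ lt₂))
    (hinj : Function.Injective x)
    (hC : ∀ i j k : Fin 3, i ≠ j → i ≠ k → j ≠ k → ¬ Crel (x i) (x j) (x k)) (k : Fin 3) :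
    ∃ l, x k = tripod n l := by
  have hle (i j k : Fin 3) (hij : i ≠ j) (hik : i ≠ k) (hjk : j ≠ k) :
      meet (x j) (x k) ≤ meet (x i) (x j) := by
    by_contra h
    exact hC i j k hij hik hjk
      (Or.inr ⟨hinj.ne hij, hinj.ne hik, hinj.ne hjk, not_le.1 h⟩)
  have heq (i j k : Fin 3) (hij : i ≠ j) (hik : i ≠ k) (hjk : j ≠ k) :
      meet (x j) (x k) = meet (x i) (x j) :=
    (hle i j k hij hik hjk).antisymm <|
      (hle k i j hik.symm hjk.symm hij).trans (hle j k i hjk hij.symm hik.symm)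
  obtain ⟨q, hq, h01, hlt01⟩ := exists_meet_eq (hinj.ne (by decide : (0 : Fin 3) ≠ 1))
  obtain ⟨r, hr, h12, hlt12⟩ := exists_meet_eq (hinj.ne (by decide : (1 : Fin 3) ≠ 2))
  obtain ⟨s, hs, h20, -⟩ := exists_meet_eq (hinj.ne (by decide : (2 : Fin 3) ≠ 0))
  obtain rfl : r = q := WithTop.coe_injective <| by
    rw [← hq, ← hr]; exact heq 0 1 2 (by decide) (by decide) (by decide)
  obtain rfl : s = r := WithTop.coe_injective <| by
    rw [← hr, ← hs]; exact heq 1 2 0 (by decide) (by decide) (by decide)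
  have hsn : s = n := by
    by_contra hne
    have hone (k : Fin 3) : x k s ≤ 1 := by
      rcases mem_configSet_iff.1 (hmem k) with ⟨l, hl⟩ | ⟨i, hi⟩
      · rw [hl, tripod_apply_of_ne l hne]; exact zero_le_one
      · exact branch_apply_le_one h₁ hi s
    have h0 := hone 0
    have h1 := hone 1
    have h2 := hone 2
    omega
  subst hsn
  have hne (l : Fin 3) (hkl : k ≠ l) : x k (n : ℚ) ≠ x l (n : ℚ) := by
    fin_cases k <;> fin_cases l <;>
      first | exact absurd rfl hkl | assumption | exact Ne.symm ‹_›
  have hbelow (l : Fin 3) (p : ℚ) (hp : p < n) : x k p = x l p := by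
    have e01 := hlt01 p hp
    have e12 := hlt12 p hp
    fin_cases k <;> fin_cases l <;> simp_all
  rcases mem_configSet_iff.1 (hmem k) with hk | ⟨i, hi⟩
  · exact hk
  · obtain ⟨l, hkl⟩ : ∃ l, k ≠ l := ⟨k + 1, by fin_cases k <;> decide⟩
    have hrank := hbelow l (rank lt₁ i) (by exact_mod_cast rank_lt h₁ i)
    rw [branch_apply_rank h₁ hi] at hrank
    rcases mem_configSet_iff.1 (hmem l) with ⟨l', hl'⟩ | ⟨j, hj⟩
    · rw [hl', tripod_apply_rank h₁] at hrank
      simp at hrank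
    · exact absurd ((branch_apply_top h₁ hi).trans (branch_apply_top h₁ hj).symm) (hne l hkl)

end Configuration

/-- A partial isomorphism between configurations induces an embedding of the patterns. -/
theorem exists_embedding_of_isPartialIso {m n : ℕ} {σ₁ σ₂ : Fin m → Fin m → Prop}
    {τ₁ τ₂ : Fin n → Fin n → Prop}
    (hσ₁ : IsStrictTotalOrder (Fin m) σ₁) (hσ₂ : IsStrictTotalOrder (Fin m) σ₂)
    (hτ₁ : IsStrictTotalOrder (Fin n) τ₁) (hτ₂ : IsStrictTotalOrder (Fin n) τ₂)
    {f : MClev → MClev} (hf : IsPartialIso (configSet (tripod m) (stem σ₁) (twig σ₁ σ₂)) f)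
    (hmaps : f '' configSet (tripod m) (stem σ₁) (twig σ₁ σ₂) ⊆
      configSet (tripod n) (stem τ₁) (twig τ₁ τ₂)) :
    ∃ h : Fin m → Fin n, Function.Injective h ∧
      (∀ i j : Fin m, σ₁ i j → τ₁ (h i) (h j)) ∧
      (∀ i j : Fin m, σ₂ i j → τ₂ (h i) (h j)) := by
  obtain ⟨hinj, hC, hV⟩ := hf
  obtain ⟨⟨ha, -, -, hab, hac, hbc⟩, hcfg₁, hcfg₂, hcfg₃, hcfg₄⟩ :=
    isConfig_tripod_stem_twig hσ₁ hσ₂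
  have ma (k : Fin 3) : tripod m k ∈ configSet (tripod m) (stem σ₁) (twig σ₁ σ₂) :=
    mem_configSet_iff.2 (Or.inl ⟨k, rfl⟩)
  have mb (i : Fin m) : stem σ₁ i ∈ configSet (tripod m) (stem σ₁) (twig σ₁ σ₂) :=
    mem_configSet_iff.2 (Or.inr ⟨i, Or.inl rfl⟩)
  have mc (i : Fin m) : twig σ₁ σ₂ i ∈ configSet (tripod m) (stem σ₁) (twig σ₁ σ₂) :=
    mem_configSet_iff.2 (Or.inr ⟨i, Or.inr rfl⟩)
  have hfa : Function.Injective fun k => f (tripod m k) :=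
    fun k l h => ha (hinj (ma k) (ma l) h)
  choose g hg using eq_tripod_of_not_Crel hτ₁ (fun k => hmaps ⟨_, ma k, rfl⟩) hfa
    fun i j k hij hik hjk h =>
      hcfg₁ i j k hij hik hjk ((hC _ (ma i) _ (ma j) _ (ma k)).2 h)
  have hgsurj : Function.Surjective g := Finite.surjective_of_injective fun k l h =>
    hfa (by simp only [hg, h])
  have himage {x : MClev} (hx : x ∈ configSet (tripod m) (stem σ₁) (twig σ₁ σ₂))
      (hxa : ∀ k, tripod m k ≠ x) : ∃ i, f x = stem τ₁ i ∨ f x = twig τ₁ τ₂ i := by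
    refine (mem_configSet_iff.1 (hmaps ⟨x, hx, rfl⟩)).resolve_left ?_
    rintro ⟨l, hl⟩
    obtain ⟨k, rfl⟩ := hgsurj l
    exact hxa k (hinj (ma k) hx ((hg k).trans hl.symm))
  choose h hb using fun i => himage (mb i) fun k => hab k i
  have hbc' (i : Fin m) : f (stem σ₁ i) ≠ f (twig σ₁ σ₂ i) := fun e =>
    hbc i i (hinj (mb i) (mc i) e)
  have hc (i : Fin m) : f (twig σ₁ σ₂ i) = stem τ₁ (h i) ∨
      f (twig σ₁ σ₂ i) = twig τ₁ τ₂ (h i) := by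
    obtain ⟨j, hj⟩ := himage (mc i) fun k => hac k i
    suffices j = h i by rwa [this] at hj
    rcases (hC _ (ma 0) _ (mb i) _ (mc i)).1 (hcfg₂ 0 i) with ⟨e, -⟩ | ⟨-, -, -, hlt⟩
    · exact absurd e (hbc' i)
    · rw [hg 0, meet_tripod_branch hτ₁ (hb i)] at hlt
      have e := eq_of_lt_meet hlt
      rw [branch_apply_rank hτ₁ (hb i), branch_apply_rank hτ₁ hj] at e
      by_contra hne
      simp [hne] at e
  have hVlt {a b c d : MClev} (hma : a ∈ configSet (tripod m) (stem σ₁) (twig σ₁ σ₂))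
      (hmb : b ∈ configSet (tripod m) (stem σ₁) (twig σ₁ σ₂))
      (hmc : c ∈ configSet (tripod m) (stem σ₁) (twig σ₁ σ₂))
      (hmd : d ∈ configSet (tripod m) (stem σ₁) (twig σ₁ σ₂))
      (hne : a ≠ b) (hne' : c ≠ d) (hlt : meet a b < meet c d) :
      meet (f a) (f b) < meet (f c) (f d) := by
    by_contra hle
    exact absurd ((hV _ hmc _ hmd _ hma _ hmb).2
      ⟨fun e => hne' (hinj hmc hmd e), fun e => hne (hinj hma hmb e), not_lt.1 hle⟩).2.2
      (not_le.2 hlt)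
  have h₁ (i j : Fin m) (hij : σ₁ i j) : τ₁ (h i) (h j) := by
    have := hVlt (ma 0) (mb i) (ma 0) (mb j) (hab 0 i) (hab 0 j) (hcfg₃ 0 i j hij)
    rw [hg 0, meet_tripod_branch hτ₁ (hb i), meet_tripod_branch hτ₁ (hb j),
      WithTop.coe_lt_coe, Nat.cast_lt] at this
    exact lt_of_rank_lt_rank hτ₁ this
  refine ⟨h, fun i j hij => ?_, h₁, fun i j hij => ?_⟩
  · rcases trichotomous_of σ₁ i j with h' | h' | h'
    · exact absurd (hij ▸ h₁ i j h') (irrefl_of τ₁ _)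
    · exact h'
    · exact absurd (hij ▸ h₁ j i h') (irrefl_of τ₁ _)
  · have := hVlt (mb i) (mc i) (mb j) (mc j) (hbc i i) (hbc j j) (hcfg₄ i j hij)
    rw [meet_branch_self (hb i) (hc i) (hbc' i), meet_branch_self (hb j) (hc j) (hbc' j),
      WithTop.coe_lt_coe, Nat.cast_lt] at this
    exact lt_of_rank_lt_rank hτ₂ (by omega)

/-- permutation patterns are faithfully encoded in `M_{C,lev}`:
there is an assignment, to every `n ≥ 2` and every pattern `σ` of size `n`, of
a σ-configuration `C_σ` in `M` such that whenever there is a partial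
isomorphism from the underlying set of `C_σ` into the underlying set of
`C_τ`, the pattern `σ` embeds into `τ`. -/
theorem patterns_encoded :
    ∃ F : (n : ℕ) → (Fin n → Fin n → Prop) → (Fin n → Fin n → Prop) →
            (Fin 3 → MClev) × (Fin n → MClev) × (Fin n → MClev),
      (∀ (n : ℕ), 2 ≤ n → ∀ lt1 lt2 : Fin n → Fin n → Prop,
        IsStrictTotalOrder (Fin n) lt1 → IsStrictTotalOrder (Fin n) lt2 →
        IsConfig lt1 lt2 (F n lt1 lt2).1 (F n lt1 lt2).2.1 (F n lt1 lt2).2.2) ∧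
      (∀ (m n : ℕ), 2 ≤ m → 2 ≤ n →
        ∀ (σ1 σ2 : Fin m → Fin m → Prop) (τ1 τ2 : Fin n → Fin n → Prop),
        IsStrictTotalOrder (Fin m) σ1 → IsStrictTotalOrder (Fin m) σ2 →
        IsStrictTotalOrder (Fin n) τ1 → IsStrictTotalOrder (Fin n) τ2 →
        (∃ f : MClev → MClev,
          IsPartialIso (configSet (F m σ1 σ2).1 (F m σ1 σ2).2.1 (F m σ1 σ2).2.2) f ∧
          f '' configSet (F m σ1 σ2).1 (F m σ1 σ2).2.1 (F m σ1 σ2).2.2 ⊆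
            configSet (F n τ1 τ2).1 (F n τ1 τ2).2.1 (F n τ1 τ2).2.2) →
        ∃ h : Fin m → Fin n, Function.Injective h ∧
          (∀ i j : Fin m, σ1 i j → τ1 (h i) (h j)) ∧
          (∀ i j : Fin m, σ2 i j → τ2 (h i) (h j))) := by
  refine ⟨fun n lt1 lt2 => (tripod n, stem lt1, twig lt1 lt2),
    fun n _ lt1 lt2 h₁ h₂ => isConfig_tripod_stem_twig h₁ h₂, ?_⟩
  rintro m n - - σ1 σ2 τ1 τ2 hσ₁ hσ₂ hτ₁ hτ₂ ⟨f, hf, hmaps⟩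
  exact exists_embedding_of_isPartialIso hσ₁ hσ₂ hτ₁ hτ₂ hf hmaps
end

section
/- For every k ≥ 2, the automorphism group of M_{C,lev} has at least k! orbits on (2k+3)-element subsets of M; precisely, there exists a family of k! subsets of M, each of cardinality 2k + 3, such that for any two distinct members S, S' of the family there is no automorphism g of (M, C, V) with g(S) = S' (as sets). -/
theorem meet_eq_coe_iff {a b : MClev} {q : ℚ} :
    meet a b = q ↔ a q ≠ b q ∧ ∀ r < q, a r = b r := by
  have mem (r : ℚ) : r ∈ (a.support ∪ b.support).filter (fun i => a i ≠ b i) ↔ a r ≠ b r := by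
    simp only [Finset.mem_filter, Finset.mem_union, Finsupp.mem_support_iff]
    grind
  unfold meet
  constructor
  · intro h
    refine ⟨(mem q).1 (Finset.mem_of_min h), fun r hr => ?_⟩
    by_contra hne
    exact absurd (Finset.min_le_of_eq ((mem r).2 hne) h) (not_le.2 hr)
  · rintro ⟨hq, hlt⟩
    refine le_antisymm (Finset.min_le ((mem q).2 hq)) (Finset.le_min fun r hr => ?_)
    rw [WithTop.coe_le_coe]
    by_contra! hlt'
    exact (mem r).1 hr (hlt r hlt')

theorem exists_meet_eq_coe {a b : MClev} (hab : a ≠ b) : ∃ q : ℚ, meet a b = q := by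
  obtain ⟨r, hr⟩ := DFunLike.ne_iff.1 hab
  have hmem : r ∈ (a.support ∪ b.support).filter (fun i => a i ≠ b i) := by
    simp only [Finset.mem_filter, Finset.mem_union, Finsupp.mem_support_iff]
    grind
  exact Finset.min_of_mem hmem

theorem ne_of_meet_eq_coe {a b : MClev} {q : ℚ} (h : meet a b = q) : a ≠ b := by
  rintro rfl
  exact (meet_eq_coe_iff.1 h).1 rfl

/-- The levels at which distinct elements of `S` branch are exactly `0, …, N - 1`. -/
def HasLevels (N : ℕ) (S : Finset MClev) : Prop :=
  (∀ a ∈ S, ∀ b ∈ S, a ≠ b → ∃ n : Fin N, meet a b = ((n : ℕ) : ℚ)) ∧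
  ∀ n : Fin N, ∃ a ∈ S, ∃ b ∈ S, meet a b = ((n : ℕ) : ℚ)

/-- An automorphism mapping `S` to `T` preserves levels when both have the same levels: it induces
a strictly monotone self-map of a finite chain, which is the identity. -/
theorem IsAut.meet_eq {g : MClev → MClev} (hg : IsAut g) {N : ℕ} {S T : Finset MClev}
    (hS : HasLevels N S) (hT : HasLevels N T) (hST : g '' (S : Set MClev) = T)
    {a b : MClev} (ha : a ∈ S) (hb : b ∈ S) (hab : a ≠ b) :
    meet (g a) (g b) = meet a b := by
  obtain ⟨⟨hinj, -⟩, -, hV⟩ := hg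
  have hmem (x : MClev) (hx : x ∈ S) : g x ∈ T := by
    rw [← Finset.mem_coe, ← hST]
    exact Set.mem_image_of_mem g hx
  have hle {x y z w : MClev} (hxy : x ≠ y) (hzw : z ≠ w) :
      meet (g x) (g y) ≤ meet (g z) (g w) ↔ meet x y ≤ meet z w := by
    have := hV x y z w
    simp only [Vrel, hinj.ne_iff] at this
    tauto
  choose u hu v hv huv using hS.2
  have hne (n : Fin N) : u n ≠ v n := ne_of_meet_eq_coe (huv n)
  choose φ hφ using fun n => hT.1 _ (hmem _ (hu n)) _ (hmem _ (hv n)) (hinj.ne (hne n))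
  have hmono : StrictMono φ := by
    refine strictMono_of_le_iff_le fun m n => ?_
    have := hle (hne m) (hne n)
    rw [hφ, hφ, huv, huv] at this
    simpa using this.symm
  have hid : φ = id :=
    (hmono.range_inj strictMono_id).1 (by
      rw [(Finite.surjective_of_injective hmono.injective).range_eq, Set.range_id])
  obtain ⟨n, hn⟩ := hS.1 a ha b hb hab
  have hn' : meet a b = meet (u n) (v n) := by rw [hn, huv]
  have key : meet (g a) (g b) = meet (g (u n)) (g (v n)) :=
    le_antisymm ((hle hab (hne n)).2 hn'.le) ((hle (hne n) hab).2 hn'.ge)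
  rw [key, hφ, hid, hn, id]

/-- A caterpillar coding a permutation: for each `i < k` a pair of points leaves the spine at
level `i` and splits at level `k + σ i`; the spine ends in three points splitting at level `2k`. -/
noncomputable def caterpillar {k : ℕ} (σ : Equiv.Perm (Fin k)) :
    (Fin k × Fin 2) ⊕ Fin 3 → MClev
  | .inl (i, b) => Finsupp.single ((i : ℕ) : ℚ) 1 + Finsupp.single ((k + σ i : ℕ) : ℚ) (b : ℕ)
  | .inr c => Finsupp.single ((2 * k : ℕ) : ℚ) (c : ℕ)

section caterpillar

variable {k : ℕ} (σ : Equiv.Perm (Fin k))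

theorem caterpillar_inl_apply (i : Fin k) (b : Fin 2) (n : ℕ) :
    caterpillar σ (.inl (i, b)) (n : ℚ) =
      (if (i : ℕ) = n then 1 else 0) + (if k + (σ i : ℕ) = n then (b : ℕ) else 0) := by
  simp only [caterpillar, Finsupp.add_apply, Finsupp.single_apply, Nat.cast_inj]

theorem caterpillar_inr_apply (c : Fin 3) (n : ℕ) :
    caterpillar σ (.inr c) (n : ℚ) = if 2 * k = n then (c : ℕ) else 0 := by
  simp only [caterpillar, Finsupp.single_apply, Nat.cast_inj]

theorem exists_nat_of_caterpillar_ne_zero {p : (Fin k × Fin 2) ⊕ Fin 3} {q : ℚ}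
    (h : caterpillar σ p q ≠ 0) : ∃ n : Fin (2 * k + 1), q = ((n : ℕ) : ℚ) := by
  rcases p with ⟨i, b⟩ | c
  · simp only [caterpillar, Finsupp.add_apply, Finsupp.single_apply] at h
    by_cases h₁ : ((i : ℕ) : ℚ) = q
    · exact ⟨⟨i, by omega⟩, h₁.symm⟩
    · by_cases h₂ : ((k + σ i : ℕ) : ℚ) = q
      · exact ⟨⟨k + σ i, by omega⟩, h₂.symm⟩
      · rw [if_neg h₁, if_neg h₂] at h
        exact absurd rfl h
  · simp only [caterpillar, Finsupp.single_apply] at h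
    exact ⟨⟨2 * k, by omega⟩, by_contra fun h' => h (if_neg (Ne.symm h'))⟩

theorem meet_caterpillar_eq_coe_iff {p p' : (Fin k × Fin 2) ⊕ Fin 3} {n : ℕ} :
    meet (caterpillar σ p) (caterpillar σ p') = (n : ℚ) ↔
      caterpillar σ p (n : ℚ) ≠ caterpillar σ p' (n : ℚ) ∧
        ∀ m < n, caterpillar σ p (m : ℚ) = caterpillar σ p' (m : ℚ) := by
  rw [meet_eq_coe_iff]
  refine and_congr_right fun _ => ⟨fun h m hm => h m (by exact_mod_cast hm), fun h r hr => ?_⟩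
  by_contra hne
  have : ∃ m : Fin (2 * k + 1), r = ((m : ℕ) : ℚ) := by
    by_cases h0 : caterpillar σ p r = 0
    · exact exists_nat_of_caterpillar_ne_zero σ (p := p') (by rw [← h0]; exact Ne.symm hne)
    · exact exists_nat_of_caterpillar_ne_zero σ h0
  obtain ⟨m, rfl⟩ := this
  exact hne (h m (by exact_mod_cast hr))

theorem caterpillar_injective : Function.Injective (caterpillar σ) := by
  intro p p' h
  have h' (n : ℕ) : caterpillar σ p (n : ℚ) = caterpillar σ p' (n : ℚ) := by rw [h]
  rcases p with ⟨i, b⟩ | c <;> rcases p' with ⟨i', b'⟩ | c'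
  · simp only [caterpillar_inl_apply] at h'
    have hi : i = i' := by
      have := h' i
      ext
      grind
    subst hi
    have hb : b = b' := by
      have := h' (k + σ i)
      ext
      grind
    rw [hb]
  · simp only [caterpillar_inl_apply, caterpillar_inr_apply] at h'
    have := h' i
    grind
  · simp only [caterpillar_inl_apply, caterpillar_inr_apply] at h'
    have := h' i'
    grind
  · simp only [caterpillar_inr_apply] at h'
    have hc : c = c' := by
      have := h' (2 * k)
      ext
      grind
    rw [hc]

theorem meet_caterpillar_pair (i : Fin k) :
    meet (caterpillar σ (.inl (i, 0))) (caterpillar σ (.inl (i, 1))) = ((k + σ i : ℕ) : ℚ) := by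
  rw [meet_caterpillar_eq_coe_iff]
  simp only [caterpillar_inl_apply]
  grind

theorem meet_caterpillar_inl_inr (i : Fin k) (b : Fin 2) (c : Fin 3) :
    meet (caterpillar σ (.inl (i, b))) (caterpillar σ (.inr c)) = ((i : ℕ) : ℚ) := by
  rw [meet_caterpillar_eq_coe_iff]
  simp only [caterpillar_inl_apply, caterpillar_inr_apply]
  grind

theorem meet_caterpillar_of_lt {i i' : Fin k} (h : i < i') (b b' : Fin 2) :
    meet (caterpillar σ (.inl (i', b'))) (caterpillar σ (.inl (i, b))) = ((i : ℕ) : ℚ) := by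
  rw [meet_caterpillar_eq_coe_iff]
  simp only [caterpillar_inl_apply]
  grind

theorem meet_caterpillar_inr :
    meet (caterpillar σ (.inr 0)) (caterpillar σ (.inr 1)) = ((2 * k : ℕ) : ℚ) := by
  rw [meet_caterpillar_eq_coe_iff]
  simp only [caterpillar_inr_apply]
  grind

/-- The set of points of the caterpillar coding `σ`. -/
noncomputable def caterpillarSet : Finset MClev :=
  Finset.univ.map ⟨caterpillar σ, caterpillar_injective σ⟩

theorem mem_caterpillarSet {a : MClev} : a ∈ caterpillarSet σ ↔ ∃ p, caterpillar σ p = a := by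
  simp only [caterpillarSet, Finset.mem_map, Finset.mem_univ, true_and,
    Function.Embedding.coeFn_mk]

theorem card_caterpillarSet : (caterpillarSet σ).card = 2 * k + 3 := by
  simp [caterpillarSet, mul_comm]

theorem hasLevels_caterpillarSet : HasLevels (2 * k + 1) (caterpillarSet σ) := by
  simp only [HasLevels, mem_caterpillarSet]
  constructor
  · rintro _ ⟨p, rfl⟩ _ ⟨p', rfl⟩ hne
    obtain ⟨q, hq⟩ := exists_meet_eq_coe hne
    have hq' := (meet_eq_coe_iff.1 hq).1
    have : ∃ n : Fin (2 * k + 1), q = ((n : ℕ) : ℚ) := by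
      by_cases h0 : caterpillar σ p q = 0
      · exact exists_nat_of_caterpillar_ne_zero σ (p := p') (by rw [← h0]; exact hq'.symm)
      · exact exists_nat_of_caterpillar_ne_zero σ h0
    obtain ⟨n, rfl⟩ := this
    exact ⟨n, hq⟩
  · rintro ⟨n, hn⟩
    rcases lt_or_ge n k with h | h
    · exact ⟨_, ⟨_, rfl⟩, _, ⟨_, rfl⟩, meet_caterpillar_inl_inr σ ⟨n, h⟩ 0 0⟩
    · rcases eq_or_ne n (2 * k) with rfl | h'
      · exact ⟨_, ⟨_, rfl⟩, _, ⟨_, rfl⟩, meet_caterpillar_inr σ⟩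
      · refine ⟨_, ⟨_, rfl⟩, _, ⟨_, rfl⟩,
          (meet_caterpillar_pair σ (σ.symm ⟨n - k, by omega⟩)).trans ?_⟩
        rw [Equiv.apply_symm_apply, Nat.add_sub_cancel' h]

/-- The order of `i` and `σ⁻¹ j` can be read off from the levels of the caterpillar. -/
theorem le_symm_iff_exists_meet (i j : Fin k) :
    i ≤ σ.symm j ↔ ∃ x ∈ caterpillarSet σ, ∃ y ∈ caterpillarSet σ, ∃ z ∈ caterpillarSet σ,
      meet x y = ((k + j : ℕ) : ℚ) ∧ meet x z = ((i : ℕ) : ℚ) := by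
  simp only [mem_caterpillarSet]
  constructor
  · intro h
    have hpair := meet_caterpillar_pair σ (σ.symm j)
    rw [Equiv.apply_symm_apply] at hpair
    rcases h.lt_or_eq with h | rfl
    · exact ⟨_, ⟨_, rfl⟩, _, ⟨_, rfl⟩, _, ⟨_, rfl⟩, hpair, meet_caterpillar_of_lt σ h 0 0⟩
    · exact ⟨_, ⟨_, rfl⟩, _, ⟨_, rfl⟩, _, ⟨_, rfl⟩, hpair, meet_caterpillar_inl_inr σ _ 0 0⟩
  · rintro ⟨_, ⟨p, rfl⟩, _, ⟨p', rfl⟩, _, ⟨r, rfl⟩, hxy, hxz⟩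
    rw [meet_caterpillar_eq_coe_iff] at hxy hxz
    by_contra! hlt
    have hnode (s) (hs : caterpillar σ s ((k + j : ℕ) : ℚ) ≠ 0) :
        caterpillar σ s (((σ.symm j : Fin k) : ℕ) : ℚ) ≠ 0 := by
      rcases s with ⟨l, b⟩ | c
      · rw [caterpillar_inl_apply] at hs ⊢
        have hl : σ l = j := by
          ext
          grind
        simp [← hl]
      · rw [caterpillar_inr_apply] at hs
        grind
    have hbranch (s) (l : Fin k) (hs : caterpillar σ s ((l : ℕ) : ℚ) ≠ 0) (m : Fin k) :
        caterpillar σ s ((m : ℕ) : ℚ) = if l = m then 1 else 0 := by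
      rcases s with ⟨l', b⟩ | c
      · rw [caterpillar_inl_apply] at hs ⊢
        grind
      · rw [caterpillar_inr_apply] at hs
        grind
    have hp : caterpillar σ p (((σ.symm j : Fin k) : ℕ) : ℚ) ≠ 0 := by
      by_cases h0 : caterpillar σ p ((k + j : ℕ) : ℚ) = 0
      · rw [hxy.2 _ (by omega)]
        exact hnode _ (by rw [← h0]; exact hxy.1.symm)
      · exact hnode _ h0
    have hr : caterpillar σ r (((σ.symm j : Fin k) : ℕ) : ℚ) ≠ 0 := by
      rwa [← hxz.2 _ hlt]
    exact hxz.1 ((hbranch p _ hp i).trans (hbranch r _ hr i).symm)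

end caterpillar

theorem eq_of_image_caterpillarSet_eq {k : ℕ} {σ τ : Equiv.Perm (Fin k)} {g : MClev → MClev}
    (hg : IsAut g)
    (h : g '' (caterpillarSet σ : Set MClev) = (caterpillarSet τ : Set MClev)) : σ = τ := by
  have hmeet {a b : MClev} (ha : a ∈ caterpillarSet σ) (hb : b ∈ caterpillarSet σ) {q : ℚ}
      (hq : meet a b = q) : meet (g a) (g b) = q :=
    (hg.meet_eq (hasLevels_caterpillarSet σ) (hasLevels_caterpillarSet τ) h ha hb
      (ne_of_meet_eq_coe hq)).trans hq
  have hmem (x : MClev) (hx : x ∈ caterpillarSet σ) : g x ∈ caterpillarSet τ := by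
    rw [← Finset.mem_coe, ← h]
    exact Set.mem_image_of_mem g hx
  have hle (j : Fin k) : σ.symm j ≤ τ.symm j := by
    obtain ⟨x, hx, y, hy, z, hz, hxy, hxz⟩ := (le_symm_iff_exists_meet σ _ j).1 le_rfl
    exact (le_symm_iff_exists_meet τ _ j).2
      ⟨g x, hmem x hx, g y, hmem y hy, g z, hmem z hz, hmeet hx hy hxy, hmeet hx hz hxz⟩
  have hsum : ∑ j, (σ.symm j : ℕ) = ∑ j, (τ.symm j : ℕ) := by
    rw [Equiv.sum_comp σ.symm (fun i : Fin k => (i : ℕ)),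
      Equiv.sum_comp τ.symm (fun i : Fin k => (i : ℕ))]
  have heq := (Finset.sum_eq_sum_iff_of_le fun j _ => Fin.le_def.1 (hle j)).1 hsum
  exact Equiv.symm_bijective.injective (Equiv.ext fun j => Fin.ext (heq j (Finset.mem_univ j)))

/-- for every `k ≥ 2` there is a family of `k!` subsets of `M`,
each of cardinality `2k + 3`, no one of which is mapped onto a different one
by an automorphism of `(M, C, V)`; hence `Aut(M_{C,lev})` has at least `k!`
orbits on `(2k+3)`-element subsets. -/
theorem many_orbits (k : ℕ) (hk : 2 ≤ k) :
    ∃ S : Fin (Nat.factorial k) → Finset MClev,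
      (∀ i, (S i).card = 2 * k + 3) ∧
      (∀ i j, i ≠ j → ∀ g : MClev → MClev, IsAut g →
        g '' (S i : Set MClev) ≠ (S j : Set MClev)) := by
  have e : Fin (Nat.factorial k) ≃ Equiv.Perm (Fin k) :=
    (Fintype.equivFinOfCardEq (by rw [Fintype.card_perm, Fintype.card_fin])).symm
  refine ⟨fun i => caterpillarSet (e i), fun i => card_caterpillarSet _, fun i j hij g hg h => ?_⟩
  exact hij (e.injective (eq_of_image_caterpillarSet_eq hg h))
end

section
/- The orbit counting sequence of Aut(M_{C,lev}) on finite subsets has super-exponential growth: for every real number c > 1 there exists K ∈ ℕ such that for every k > K there are more than c^k orbits of the automorphism group of (M, C, V) on k-element subsets of M; precisely, for every k > K there exist a natural number N with N > c^k and N subsets of M of cardinality k such that no automorphism of (M, C, V) maps one of these subsets onto a different one. -/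
theorem meet_self (a : MClev) : meet a a = ⊤ := by
  simp [meet]

theorem meet_eq_coe_s9 {a b : MClev} {q : ℚ} (hq : a q ≠ b q) (hlt : ∀ r < q, a r = b r) :
    meet a b = (q : WithTop ℚ) := by
  apply le_antisymm
  · apply Finset.min_le
    simp only [Finset.mem_filter, Finset.mem_union, Finsupp.mem_support_iff]
    exact ⟨by omega, hq⟩
  · apply Finset.le_min
    intro r hr
    by_contra! h
    exact (Finset.mem_filter.1 hr).2 (hlt r (WithTop.coe_lt_coe.1 h))

theorem IsAut.meet_le_iff {g : MClev → MClev} (hg : IsAut g) {a b c d : MClev}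
    (hab : a ≠ b) (hcd : c ≠ d) :
    meet (g a) (g b) ≤ meet (g c) (g d) ↔ meet a b ≤ meet c d := by
  have h := hg.2.2 a b c d
  simp only [Vrel, hab, hcd, hg.1.1.ne hab, hg.1.1.ne hcd, ne_eq, not_false_eq_true,
    true_and] at h
  exact h.symm

/-- The level at which a vertex of a decorated comb branches off the spine. -/
def combPos {n m : ℕ} : Fin (n + 1) ⊕ Fin m → ℕ :=
  Sum.elim (fun i => i) (fun i => i)

/-- A comb with `n + 1` teeth, the `i`-th of which is split at level `n + σ i` for `i < m`. -/
noncomputable def combPoint {n m : ℕ} (σ : Equiv.Perm (Fin m)) :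
    Fin (n + 1) ⊕ Fin m → MClev :=
  Sum.elim (fun i => Finsupp.single (i : ℚ) 1)
    (fun i => Finsupp.single (i : ℚ) 1 + Finsupp.single (n + σ i : ℚ) 1)

section Comb

variable {n m : ℕ} (σ : Equiv.Perm (Fin m))

theorem combPoint_of_lt (hmn : m ≤ n) (t : Fin (n + 1) ⊕ Fin m) {q : ℚ} (hq : q < combPos t) :
    combPoint σ t q = 0 := by
  rcases t with i | i
  · simp only [combPos, combPoint, Sum.elim_inl] at hq ⊢
    exact Finsupp.single_eq_of_ne hq.ne
  · simp only [combPos, combPoint, Sum.elim_inr] at hq ⊢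
    have h1 : (i : ℚ) ≤ n := by exact_mod_cast i.2.le.trans hmn
    have h2 : (0 : ℚ) ≤ (σ i : ℕ) := by positivity
    rw [Finsupp.add_apply, Finsupp.single_eq_of_ne hq.ne,
      Finsupp.single_eq_of_ne (by linarith : q < n + (σ i : ℕ)).ne, add_zero]

theorem combPoint_pos_ne_zero (t : Fin (n + 1) ⊕ Fin m) :
    combPoint σ t (combPos t) ≠ 0 := by
  rcases t with i | i <;> simp [combPos, combPoint]

theorem meet_combPoint_of_lt (hmn : m ≤ n) {s t : Fin (n + 1) ⊕ Fin m}
    (h : combPos s < combPos t) :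
    meet (combPoint σ s) (combPoint σ t) = ((combPos s : ℚ) : WithTop ℚ) := by
  have hq : (combPos s : ℚ) < combPos t := by exact_mod_cast h
  apply meet_eq_coe_s9
  · rw [combPoint_of_lt σ hmn t hq]
    exact combPoint_pos_ne_zero σ s
  · intro r hr
    rw [combPoint_of_lt σ hmn s hr, combPoint_of_lt σ hmn t (hr.trans hq)]

theorem meet_combPoint_of_ne (hmn : m ≤ n) {s t : Fin (n + 1) ⊕ Fin m}
    (h : combPos s ≠ combPos t) :
    meet (combPoint σ s) (combPoint σ t) =
      (((min (combPos s) (combPos t) : ℕ) : ℚ) : WithTop ℚ) := by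
  rcases h.lt_or_gt with h | h
  · rw [meet_combPoint_of_lt σ hmn h, min_eq_left h.le]
  · rw [meet_comm, meet_combPoint_of_lt σ hmn h, min_eq_right h.le]

theorem meet_combPoint_cherry {i : Fin (n + 1)} {j : Fin m} (hij : (i : ℕ) = j) :
    meet (combPoint σ (.inl i)) (combPoint (n := n) σ (.inr j)) =
      (((n + σ j : ℕ) : ℚ) : WithTop ℚ) := by
  apply meet_eq_coe_s9
  · simp [combPoint, hij]
  · intro r hr
    push_cast at hr
    simp [combPoint, hij, Finsupp.single_eq_of_ne hr.ne]

theorem exists_cherry {s t : Fin (n + 1) ⊕ Fin m} (hst : s ≠ t)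
    (h : combPos s = combPos t) :
    ∃ (i : Fin (n + 1)) (j : Fin m), (i : ℕ) = j ∧
      (s = .inl i ∧ t = .inr j ∨ s = .inr j ∧ t = .inl i) := by
  rcases s with i | i <;> rcases t with j | j <;> simp only [combPos, Sum.elim_inl,
    Sum.elim_inr] at h
  · exact absurd (congrArg Sum.inl (Fin.ext h)) hst
  · exact ⟨i, j, h, .inl ⟨rfl, rfl⟩⟩
  · exact ⟨j, i, h.symm, .inr ⟨rfl, rfl⟩⟩
  · exact absurd (congrArg Sum.inr (Fin.ext h)) hst

theorem meet_combPoint_of_eq {s t : Fin (n + 1) ⊕ Fin m} (hst : s ≠ t)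
    (h : combPos s = combPos t) :
    ∃ j : Fin m, combPos s = j ∧
      meet (combPoint σ s) (combPoint σ t) = (((n + σ j : ℕ) : ℚ) : WithTop ℚ) := by
  obtain ⟨i, j, hij, ⟨rfl, rfl⟩ | ⟨rfl, rfl⟩⟩ := exists_cherry hst h
  · exact ⟨j, hij, meet_combPoint_cherry σ hij⟩
  · exact ⟨j, rfl, by rw [meet_comm]; exact meet_combPoint_cherry σ hij⟩

theorem combPos_le (hmn : m ≤ n) (t : Fin (n + 1) ⊕ Fin m) : combPos t ≤ n := by
  rcases t with i | i <;> simp only [combPos, Sum.elim_inl, Sum.elim_inr] <;> omega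

theorem exists_level (hmn : m ≤ n) {s t : Fin (n + 1) ⊕ Fin m} (hst : s ≠ t) :
    ∃ l : Fin (n + m),
      meet (combPoint σ s) (combPoint σ t) = (((l : ℕ) : ℚ) : WithTop ℚ) := by
  by_cases h : combPos s = combPos t
  · obtain ⟨j, -, hj⟩ := meet_combPoint_of_eq σ hst h
    exact ⟨⟨n + σ j, by omega⟩, hj⟩
  · have h1 := combPos_le hmn s
    have h2 := combPos_le hmn t
    exact ⟨⟨min (combPos s) (combPos t), by omega⟩, meet_combPoint_of_ne σ hmn h⟩

theorem exists_pair_of_level (hmn : m ≤ n) (l : Fin (n + m)) :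
    ∃ s t : Fin (n + 1) ⊕ Fin m, s ≠ t ∧
      meet (combPoint σ s) (combPoint σ t) = (((l : ℕ) : ℚ) : WithTop ℚ) := by
  by_cases hl : (l : ℕ) < n
  · refine ⟨.inl ⟨l, by omega⟩, .inl (Fin.last n), ?_, ?_⟩
    · simp only [ne_eq, Sum.inl.injEq, Fin.ext_iff, Fin.val_last]
      omega
    · exact meet_combPoint_of_lt σ hmn (by simpa [combPos] using hl)
  · let j : Fin m := σ.symm ⟨l - n, by omega⟩
    refine ⟨.inl ⟨j, by omega⟩, .inr j, Sum.inl_ne_inr, ?_⟩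
    rw [meet_combPoint_cherry σ rfl]
    have : n + (σ j : ℕ) = l := by
      simp only [j, Equiv.apply_symm_apply]
      omega
    rw [this]

theorem combPoint_injective (hmn : m ≤ n) :
    Function.Injective (combPoint (n := n) σ) := by
  intro s t h
  by_contra hst
  obtain ⟨l, hl⟩ := exists_level σ hmn hst
  rw [h, meet_self] at hl
  exact WithTop.top_ne_coe hl

/-- Two points meeting at a level `n + σ i` form the split `i`-th tooth, so each of them meets
any third point at level at most `i`. -/
theorem level_le_of_cherry (hmn : m ≤ n) {s t u : Fin (n + 1) ⊕ Fin m}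
    (hst : s ≠ t) (hsu : s ≠ u) (htu : t ≠ u) {i : Fin m} {l : ℕ}
    (h : meet (combPoint σ s) (combPoint σ t) = (((n + σ i : ℕ) : ℚ) : WithTop ℚ))
    (hl : meet (combPoint σ s) (combPoint σ u) = ((l : ℚ) : WithTop ℚ)) : l ≤ i := by
  have hpos : combPos s = combPos t := by
    by_contra hne
    rw [meet_combPoint_of_ne σ hmn hne] at h
    have h' : min (combPos s) (combPos t) = n + (σ i : ℕ) := by exact_mod_cast h
    have h1 := combPos_le hmn s
    have h2 := combPos_le hmn t
    omega
  obtain ⟨a, j, haj, hc⟩ := exists_cherry hst hpos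
  have hji : combPos s = i := by
    obtain ⟨j', hj', hm⟩ := meet_combPoint_of_eq σ hst hpos
    rw [h] at hm
    have h' : n + (σ i : ℕ) = n + σ j' := by exact_mod_cast hm
    have : i = j' := σ.injective (Fin.ext (by omega))
    rw [hj', this]
  have hu : combPos s ≠ combPos u := by
    intro hu
    obtain ⟨a', j', haj', hc'⟩ := exists_cherry hsu hu
    rcases hc with ⟨rfl, rfl⟩ | ⟨rfl, rfl⟩ <;> rcases hc' with ⟨h1, rfl⟩ | ⟨h1, rfl⟩
    · rw [Sum.inl.injEq] at h1
      exact htu (congrArg _ (Fin.ext (by omega)))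
    · exact Sum.inl_ne_inr h1
    · exact Sum.inr_ne_inl h1
    · rw [Sum.inr.injEq] at h1
      exact htu (congrArg _ (Fin.ext (by omega)))
  rw [meet_combPoint_of_ne σ hmn hu] at hl
  have h' : min (combPos s) (combPos u) = l := by exact_mod_cast hl
  omega

end Comb

theorem StrictMono.eq_id_of_fin {n : ℕ} {f : Fin n → Fin n} (hf : StrictMono f) (i : Fin n) :
    f i = i :=
  le_antisymm hf.apply_le hf.le_apply

theorem Equiv.Perm.eq_one_of_forall_le {m : ℕ} (π : Equiv.Perm (Fin m)) (h : ∀ i, i ≤ π i) :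
    π = 1 := by
  have hsum : ∑ i : Fin m, (i : ℕ) = ∑ i, (π i : ℕ) := (Equiv.sum_comp π fun i => (i : ℕ)).symm
  ext i
  exact ((Finset.sum_eq_sum_iff_of_le fun i _ => Fin.le_def.1 (h i)).1 hsum i
    (Finset.mem_univ i)).symm

/-- An automorphism carrying one decorated comb to another preserves all the levels. -/
theorem IsAut.meet_combPoint_eq {n m : ℕ} (hmn : m ≤ n) {σ τ : Equiv.Perm (Fin m)}
    {g : MClev → MClev} (hg : IsAut g) {γ : Fin (n + 1) ⊕ Fin m → Fin (n + 1) ⊕ Fin m}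
    (hγ : ∀ t, g (combPoint σ t) = combPoint τ (γ t)) (hinj : Function.Injective γ)
    {s t : Fin (n + 1) ⊕ Fin m} (hst : s ≠ t) :
    meet (combPoint τ (γ s)) (combPoint τ (γ t)) =
      meet (combPoint σ s) (combPoint σ t) := by
  have hp := combPoint_injective (n := n) σ hmn
  have key : ∀ {s t s' t' : Fin (n + 1) ⊕ Fin m}, s ≠ t → s' ≠ t' →
      (meet (combPoint τ (γ s)) (combPoint τ (γ t)) ≤
        meet (combPoint τ (γ s')) (combPoint τ (γ t')) ↔
      meet (combPoint σ s) (combPoint σ t) ≤ meet (combPoint σ s') (combPoint σ t')) := by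
    intro s t s' t' h h'
    simp only [← hγ]
    exact hg.meet_le_iff (hp.ne h) (hp.ne h')
  choose a b hab hl using exists_pair_of_level (n := n) σ hmn
  choose φ hφ using fun l => exists_level τ hmn (hinj.ne (hab l))
  have hmono : StrictMono φ := by
    apply strictMono_of_le_iff_le
    intro l l'
    have h := key (hab l) (hab l')
    rw [hφ, hφ, hl, hl] at h
    simpa using h.symm
  obtain ⟨l, hst'⟩ := exists_level σ hmn hst
  have heq : meet (combPoint τ (γ (a l))) (combPoint τ (γ (b l))) =
      (((l : ℕ) : ℚ) : WithTop ℚ) := by rw [hφ, hmono.eq_id_of_fin]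
  rw [hst', ← heq]
  exact le_antisymm ((key hst (hab l)).2 (by rw [hst', hl]))
    ((key (hab l) hst).2 (by rw [hst', hl]))

theorem eq_of_isAut_image_range_combPoint {n m : ℕ} (hmn : m ≤ n) {σ τ : Equiv.Perm (Fin m)}
    {g : MClev → MClev} (hg : IsAut g)
    (h : g '' Set.range (combPoint (n := n) σ) = Set.range (combPoint (n := n) τ)) :
    σ = τ := by
  have hex : ∀ t : Fin (n + 1) ⊕ Fin m, ∃ t', g (combPoint σ t) = combPoint (n := n) τ t' := by
    intro t
    have : g (combPoint (n := n) σ t) ∈ Set.range (combPoint (n := n) τ) :=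
      h ▸ Set.mem_image_of_mem g (Set.mem_range_self t)
    obtain ⟨t', ht'⟩ := this
    exact ⟨t', ht'.symm⟩
  choose γ hγ using hex
  have hinj : Function.Injective γ := by
    intro s t hst
    apply combPoint_injective σ hmn
    apply hg.1.1
    rw [hγ, hγ, hst]
  have hone : σ.trans τ.symm = 1 := by
    apply Equiv.Perm.eq_one_of_forall_le
    intro i
    let x : Fin (n + 1) ⊕ Fin m := .inl ⟨i, by omega⟩
    let y : Fin (n + 1) ⊕ Fin m := .inr i
    let z : Fin (n + 1) ⊕ Fin m := .inl (Fin.last n)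
    have hxy : x ≠ y := Sum.inl_ne_inr
    have hyz : y ≠ z := Sum.inr_ne_inl
    have hxz : x ≠ z := by
      simp only [x, z, ne_eq, Sum.inl.injEq, Fin.ext_iff, Fin.val_last]
      omega
    have h1 := hg.meet_combPoint_eq hmn hγ hinj hxy
    have h2 := hg.meet_combPoint_eq hmn hγ hinj hxz
    rw [meet_combPoint_cherry σ rfl] at h1
    rw [meet_combPoint_of_lt σ hmn (by simp [x, z, combPos]; omega)] at h2
    refine level_le_of_cherry τ hmn (hinj.ne hxy) (hinj.ne hxz) (hinj.ne hyz)
      (i := τ.symm (σ i)) ?_ h2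
    simpa using h1
  ext i
  have := congrArg τ (Equiv.congr_fun hone i)
  simpa using congrArg Fin.val this

theorem eventually_pow_lt_factorial_half (c : ℝ) (hc : 1 < c) :
    ∃ K : ℕ, ∀ k : ℕ, K < k → c ^ k < (((k - 1) / 2).factorial : ℝ) := by
  have hc0 : 0 < c ^ 2 := by positivity
  have h := (FloorSemiring.tendsto_pow_div_factorial_atTop (c ^ 2)).eventually
    (gt_mem_nhds (inv_pos.2 hc0))
  obtain ⟨M, hM⟩ := Filter.eventually_atTop.1 h
  refine ⟨2 * M + 1, fun k hk => ?_⟩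
  have hm := hM ((k - 1) / 2) (by omega)
  rw [div_lt_iff₀ (by positivity), inv_mul_eq_div, lt_div_iff₀ hc0, ← pow_succ, ← pow_mul] at hm
  exact (pow_le_pow_right₀ hc.le (by omega)).trans_lt hm

/-- the orbit counting sequence of `Aut(M_{C,lev})` on finite
subsets has super-exponential growth: for every real `c > 1` there is `K` such
that for every `k > K` there are more than `c^k` orbits on `k`-element subsets
of `M`. -/
theorem orbit_growth_superexponential (c : ℝ) (hc : 1 < c) :
    ∃ K : ℕ, ∀ k : ℕ, K < k →
      ∃ N : ℕ, c ^ k < (N : ℝ) ∧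
        ∃ S : Fin N → Finset MClev,
          (∀ i, (S i).card = k) ∧
          (∀ i j, i ≠ j → ∀ g : MClev → MClev, IsAut g →
            g '' (S i : Set MClev) ≠ (S j : Set MClev)) := by
  obtain ⟨K, hK⟩ := eventually_pow_lt_factorial_half c hc
  refine ⟨K, fun k hk => ?_⟩
  obtain ⟨m, hm⟩ : ∃ m, m = (k - 1) / 2 := ⟨_, rfl⟩
  obtain ⟨n, hn⟩ : ∃ n, n = k - 1 - m := ⟨_, rfl⟩
  have hmn : m ≤ n := by omega
  let e : Fin m.factorial ≃ Equiv.Perm (Fin m) :=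
    (Fintype.equivFinOfCardEq (by rw [Fintype.card_perm, Fintype.card_fin])).symm
  refine ⟨m.factorial, hm ▸ hK k hk,
    fun i => Finset.univ.map ⟨combPoint (n := n) (e i), combPoint_injective _ hmn⟩,
    fun i => ?_, fun i j hij g hg h => hij (e.injective ?_)⟩
  · simp only [Finset.card_map, Finset.card_univ, Fintype.card_sum, Fintype.card_fin]
    omega
  · exact eq_of_isAut_image_range_combPoint hmn hg (by simpa using h)
end

section
/- The automorphism group of M_{C,lev} is oligomorphic: for every n ≥ 1, the diagonal action of the automorphism group of (M, C, V) on the set Mⁿ of n-tuples from M has only finitely many orbits. -/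
theorem meet_le_of_ne {a b : MClev} {j : ℚ} (hne : a j ≠ b j) : meet a b ≤ j := by
  refine Finset.min_le ?_
  simp only [Finset.mem_filter, Finset.mem_union, Finsupp.mem_support_iff]
  refine ⟨?_, hne⟩
  by_contra! h0
  exact hne (h0.1.trans h0.2.symm)

theorem coe_le_meet_iff {a b : MClev} {i : ℚ} :
    (i : WithTop ℚ) ≤ meet a b ↔ ∀ j < i, a j = b j := by
  constructor
  · intro h j hj
    by_contra hne
    exact absurd (WithTop.coe_le_coe.1 (h.trans (meet_le_of_ne hne))) (not_le.2 hj)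
  · intro h
    refine Finset.le_min fun j hj => WithTop.coe_le_coe.2 ?_
    by_contra! hlt
    exact (Finset.mem_filter.1 hj).2 (h j hlt)

theorem eq_of_forall_coe_le_iff {x y : WithTop ℚ}
    (h : ∀ i : ℚ, (i : WithTop ℚ) ≤ x ↔ (i : WithTop ℚ) ≤ y) : x = y :=
  le_antisymm (WithTop.forall_coe_le_iff_le.1 fun i => (h i).1)
    (WithTop.forall_coe_le_iff_le.1 fun i => (h i).2)

theorem exists_min_ne {a b : MClev} (h : a ≠ b) :
    ∃ i : ℚ, a i ≠ b i ∧ ∀ j < i, a j = b j := by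
  obtain ⟨i, hi⟩ := WithTop.ne_top_iff_exists.1 (mt meet_eq_top_iff.1 h)
  exact ⟨i, (Finset.mem_filter.1 (Finset.mem_of_min hi.symm)).2, coe_le_meet_iff.1 hi.le⟩

theorem coe_lt_meet_iff {a b : MClev} {i : ℚ} :
    (i : WithTop ℚ) < meet a b ↔ ∀ j ≤ i, a j = b j := by
  constructor
  · intro h j hj
    by_contra hne
    exact absurd (WithTop.coe_lt_coe.1 (h.trans_le (meet_le_of_ne hne))) (not_lt.2 hj)
  · intro h
    rcases eq_or_ne a b with rfl | hab
    · rw [meet_eq_top_iff.2 rfl]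
      exact WithTop.coe_lt_top i
    · obtain ⟨k, hk, hlt⟩ := exists_min_ne hab
      have hik : i < k := lt_of_not_ge fun hki => hk (h k hki)
      exact (WithTop.coe_lt_coe.2 hik).trans_le (coe_le_meet_iff.2 hlt)

theorem isAut_of_strictMono {g : MClev → MClev} (hg : Function.Bijective g)
    {φ : WithTop ℚ → WithTop ℚ} (hφ : StrictMono φ)
    (h : ∀ a b, meet (g a) (g b) = φ (meet a b)) : IsAut g := by
  refine ⟨hg, fun a b c => ?_, fun a b c d => ?_⟩
  · simp only [Crel, h, hφ.lt_iff_lt, hg.1.eq_iff, ne_eq]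
  · simp only [Vrel, h, hφ.le_iff_le, hg.1.eq_iff, ne_eq]

open Classical in
/-- Exchange the values `k` and `l` at position `i` for those functions that agree with `b`
below `i`. -/
noncomputable def coneSwapFun (b : MClev) (i : ℚ) (k l : ℕ) (a : MClev) : MClev :=
  if ∀ j < i, a j = b j then a.update i (Equiv.swap k l (a i)) else a

section coneSwap

variable {b a : MClev} {i : ℚ} {k l : ℕ}

theorem coneSwapFun_of_agree (h : ∀ j < i, a j = b j) :
    coneSwapFun b i k l a = a.update i (Equiv.swap k l (a i)) :=
  if_pos h

theorem coneSwapFun_of_not_agree (h : ¬ ∀ j < i, a j = b j) : coneSwapFun b i k l a = a :=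
  if_neg h

theorem coneSwapFun_apply_of_ne {j : ℚ} (hj : j ≠ i) : coneSwapFun b i k l a j = a j := by
  unfold coneSwapFun
  split_ifs
  · simp [Finsupp.update_apply, hj]
  · rfl

theorem coneSwapFun_involutive (b : MClev) (i : ℚ) (k l : ℕ) :
    Function.Involutive (coneSwapFun b i k l) := by
  intro a
  by_cases h : ∀ j < i, a j = b j
  · have h' : ∀ j < i, coneSwapFun b i k l a j = b j := fun j hj => by
      rw [coneSwapFun_apply_of_ne hj.ne, h j hj]
    rw [coneSwapFun_of_agree h', coneSwapFun_of_agree h]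
    ext j
    simp [Finsupp.update_apply]
  · rw [coneSwapFun_of_not_agree h, coneSwapFun_of_not_agree h]

end coneSwap

/-- The permutation given by `coneSwapFun`. -/
noncomputable def coneSwap (b : MClev) (i : ℚ) (k l : ℕ) : Equiv.Perm MClev :=
  (coneSwapFun_involutive b i k l).toPerm

theorem meet_coneSwap (b : MClev) (i : ℚ) (k l : ℕ) (a c : MClev) :
    meet (coneSwap b i k l a) (coneSwap b i k l c) = meet a c := by
  have key : ∀ (m : ℚ) (a c : MClev), (∀ j < m, a j = c j) →
      ∀ j < m, coneSwapFun b i k l a j = coneSwapFun b i k l c j := by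
    intro m a c h j hj
    rcases eq_or_ne j i with rfl | hji
    · by_cases ha : ∀ j' < j, a j' = b j'
      · have hc : ∀ j' < j, c j' = b j' := fun j' hj' => (h j' (hj'.trans hj)).symm.trans (ha j' hj')
        rw [coneSwapFun_of_agree ha, coneSwapFun_of_agree hc, h j hj]
        simp [Finsupp.update_apply]
      · have hc : ¬ ∀ j' < j, c j' = b j' := fun hc =>
          ha fun j' hj' => (h j' (hj'.trans hj)).trans (hc j' hj')
        rw [coneSwapFun_of_not_agree ha, coneSwapFun_of_not_agree hc, h j hj]
    · rw [coneSwapFun_apply_of_ne hji, coneSwapFun_apply_of_ne hji, h j hj]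
  refine eq_of_forall_coe_le_iff fun m => ?_
  simp only [coe_le_meet_iff]
  refine ⟨fun h => ?_, key m a c⟩
  have := key m _ _ h
  change ∀ j < m, coneSwapFun b i k l (coneSwapFun b i k l a) j =
    coneSwapFun b i k l (coneSwapFun b i k l c) j at this
  rwa [coneSwapFun_involutive b i k l a, coneSwapFun_involutive b i k l c] at this

/-- Two points having the same meets with all elements of `A` are related by a meet-preserving
permutation fixing `A` pointwise. -/
theorem exists_perm_fixing (A : Set MClev) (v : MClev) (N : ℕ) :
    ∀ u : MClev, (u.neLocus v).card = N → (∀ c ∈ A, meet u c = meet v c) →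
    ∃ g : Equiv.Perm MClev, (∀ a b, meet (g a) (g b) = meet a b) ∧ (∀ c ∈ A, g c = c) ∧
      g u = v := by
  induction N using Nat.strong_induction_on with
  | _ N ih =>
  intro u hN hA
  by_cases huv : u = v
  · exact ⟨Equiv.refl _, fun _ _ => rfl, fun _ _ => rfl, huv⟩
  obtain ⟨i, hi, hlt⟩ := exists_min_ne huv
  set s := coneSwap u i (u i) (v i)
  have hsu : s u = u.update i (v i) := by
    change coneSwapFun _ _ _ _ _ = _
    rw [coneSwapFun_of_agree fun _ _ => rfl, Equiv.swap_apply_left]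
  have hsA : ∀ c ∈ A, s c = c := by
    intro c hc
    change coneSwapFun _ _ _ _ _ = _
    by_cases h : ∀ j < i, c j = u j
    · have key : ∀ w w' : MClev, meet w c = meet w' c → w i ≠ w' i → (∀ j < i, c j = w j) →
          c i ≠ w i := by
        intro w w' hm hne hw hci
        have hlt : (i : WithTop ℚ) < meet w c := coe_lt_meet_iff.2 fun j hj => by
          rcases hj.eq_or_lt with rfl | hj
          exacts [hci.symm, (hw j hj).symm]
        rw [hm] at hlt
        exact hne (hci.symm.trans (coe_lt_meet_iff.1 hlt i le_rfl).symm)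
      have h1 : c i ≠ u i := key u v (hA c hc) hi h
      have h2 : c i ≠ v i := key v u (hA c hc).symm hi.symm fun j hj => (h j hj).trans (hlt j hj)
      rw [coneSwapFun_of_agree h, Equiv.swap_apply_of_ne_of_ne h1 h2, Finsupp.update_self]
    · exact coneSwapFun_of_not_agree h
  have hcard : ((s u).neLocus v).card < N := by
    rw [← hN, hsu]
    refine Finset.card_lt_card ((Finset.ssubset_iff_of_subset fun j => ?_).2 ⟨i, ?_, ?_⟩)
    · rcases eq_or_ne j i with rfl | hj <;> simp [Finsupp.update_apply, *]
    · simpa using hi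
    · simp
  obtain ⟨g, hg, hgA, hgu⟩ := ih _ hcard (s u) rfl fun c hc => by
    rw [← hA c hc]
    nth_rw 1 [← hsA c hc]
    exact meet_coneSwap ..
  refine ⟨s.trans g, fun a b => (hg _ _).trans (meet_coneSwap ..), fun c hc => ?_, hgu⟩
  rw [Equiv.trans_apply, hsA c hc, hgA c hc]

theorem exists_perm_of_meet_eq {ι : Type*} [Fintype ι] (x y : ι → MClev)
    (h : ∀ s t, meet (x s) (x t) = meet (y s) (y t)) :
    ∃ g : Equiv.Perm MClev, (∀ a b, meet (g a) (g b) = meet a b) ∧ ∀ t, g (x t) = y t := by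
  classical
  suffices ∀ S : Finset ι, ∃ g : Equiv.Perm MClev, (∀ a b, meet (g a) (g b) = meet a b) ∧
      ∀ t ∈ S, g (x t) = y t by
    simpa using this Finset.univ
  intro S
  induction S using Finset.induction_on with
  | empty => exact ⟨Equiv.refl _, fun _ _ => rfl, by simp⟩
  | insert t S _ ih =>
    obtain ⟨g, hg, hgS⟩ := ih
    obtain ⟨f, hf, hfS, hft⟩ := exists_perm_fixing (y '' S) (y t) _ (g (x t)) rfl (by
      rintro _ ⟨s, hs, rfl⟩
      rw [← hgS s hs, hg, h, hgS s hs])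
    refine ⟨g.trans f, fun a b => (hf _ _).trans (hg _ _), fun s hs => ?_⟩
    rcases Finset.mem_insert.1 hs with rfl | hs
    · exact hft
    · rw [Equiv.trans_apply, hgS s hs, hfS _ ⟨s, hs, rfl⟩]

/-- A finite partial order isomorphism of `ℚ` extends to an automorphism. -/
theorem exists_orderIso_extending {ι : Type*} [Finite ι] (p q : ι → ℚ)
    (h : ∀ s t, p s ≤ p t ↔ q s ≤ q t) : ∃ σ : ℚ ≃o ℚ, ∀ s, σ (p s) = q s := by
  classical
  have := Fintype.ofFinite ι
  let f₀ : Order.PartialIso ℚ ℚ := ⟨Finset.univ.image fun s => (p s, q s), by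
    simp only [Finset.mem_image, Finset.mem_univ, true_and]
    rintro _ ⟨s, rfl⟩ _ ⟨t, rfl⟩
    have hst := h s t
    have hts := h t s
    rcases lt_trichotomy (p s) (p t) with hlt | heq | hgt
    · rw [(cmp_eq_lt_iff _ _).2 hlt, (cmp_eq_lt_iff _ _).2 (not_le.1 (mt hts.2 hlt.not_ge))]
    · rw [(cmp_eq_eq_iff _ _).2 heq,
        (cmp_eq_eq_iff _ _).2 (le_antisymm (hst.1 heq.le) (hts.1 heq.ge))]
    · rw [(cmp_eq_gt_iff _ _).2 hgt, (cmp_eq_gt_iff _ _).2 (not_le.1 (mt hst.2 hgt.not_ge))]⟩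
  let toCofinal : ℚ ⊕ ℚ → Order.Cofinal (Order.PartialIso ℚ ℚ) := fun r =>
    Sum.recOn r (Order.PartialIso.definedAtLeft ℚ) (Order.PartialIso.definedAtRight ℚ)
  let I : Order.Ideal (Order.PartialIso ℚ ℚ) := Order.idealOfCofinals f₀ toCofinal
  let F a := Order.PartialIso.funOfIdeal a I
    (Order.cofinal_meets_idealOfCofinals _ toCofinal (Sum.inl a))
  let G b := Order.PartialIso.invOfIdeal b I
    (Order.cofinal_meets_idealOfCofinals _ toCofinal (Sum.inr b))
  have hcmp : ∀ a b, cmp a (G b).val = cmp (F a).val b := fun a b => by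
    rcases (F a).prop with ⟨f, hf, ha⟩
    rcases (G b).prop with ⟨g, hg, hb⟩
    rcases I.directed _ hf _ hg with ⟨m, _, fm, gm⟩
    exact m.prop (a, _) (fm ha) (_, b) (gm hb)
  refine ⟨OrderIso.ofCmpEqCmp (fun a => (F a).val) (fun b => (G b).val) hcmp, fun s => ?_⟩
  change (F (p s)).val = q s
  rcases (F (p s)).prop with ⟨f, hf, ha⟩
  rcases I.directed _ hf _ (Order.mem_idealOfCofinals f₀ toCofinal) with ⟨m, _, fm, gm⟩
  have h0 : (p s, q s) ∈ f₀.val := Finset.mem_image_of_mem _ (Finset.mem_univ s)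
  have := m.prop _ (fm ha) _ (gm h0)
  simpa using this.symm

theorem meet_equivMapDomain (σ : ℚ ≃o ℚ) (a b : MClev) :
    meet (Finsupp.equivMapDomain σ.toEquiv a) (Finsupp.equivMapDomain σ.toEquiv b) =
      σ.withTopCongr (meet a b) := by
  refine eq_of_forall_coe_le_iff fun i => ?_
  have : (i : WithTop ℚ) ≤ σ.withTopCongr (meet a b) ↔
      ((σ.symm i : ℚ) : WithTop ℚ) ≤ meet a b := by
    rw [← σ.withTopCongr.le_iff_le (x := ((σ.symm i : ℚ) : WithTop ℚ))]
    simp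
  rw [this]
  simp only [coe_le_meet_iff, Finsupp.equivMapDomain_apply]
  constructor
  · intro h j hj
    simpa using h (σ j) (σ.lt_symm_apply.1 hj)
  · intro h j hj
    exact h _ (σ.symm.lt_iff_lt.2 hj)

/-- The order pattern of the meets of the entries of a tuple. -/
def meetPattern {ι : Type*} (x : ι → MClev) : Set ((ι × ι) × (ι × ι)) :=
  {q | meet (x q.1.1) (x q.1.2) ≤ meet (x q.2.1) (x q.2.2)}

theorem exists_isAut_of_meetPattern_eq {ι : Type*} [Fintype ι] {x y : ι → MClev}
    (h : meetPattern x = meetPattern y) :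
    ∃ g : MClev → MClev, IsAut g ∧ ∀ t, g (x t) = y t := by
  have hle : ∀ s t s' t', meet (x s) (x t) ≤ meet (x s') (x t') ↔
      meet (y s) (y t) ≤ meet (y s') (y t') := fun s t s' t' =>
    Set.ext_iff.1 h ((s, t), (s', t'))
  have htop : ∀ s t, meet (x s) (x t) = ⊤ ↔ meet (y s) (y t) = ⊤ := fun s t => by
    have := hle s s s t
    rwa [meet_eq_top_iff.2 (rfl : x s = x s), meet_eq_top_iff.2 (rfl : y s = y s),
      top_le_iff, top_le_iff] at this
  let J := {r : ι × ι // meet (x r.1) (x r.2) ≠ ⊤}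
  obtain ⟨σ, hσ⟩ := exists_orderIso_extending
    (fun r : J => (meet (x r.1.1) (x r.1.2)).untop r.2)
    (fun r : J => (meet (y r.1.1) (y r.1.2)).untop (mt (htop _ _).2 r.2))
    (fun r r' => by
      rw [← WithTop.coe_le_coe, ← WithTop.coe_le_coe (α := ℚ) (a := (meet (y _) _).untop _)]
      simp only [WithTop.coe_untop]
      exact hle _ _ _ _)
  have hm : ∀ s t, σ.withTopCongr (meet (x s) (x t)) = meet (y s) (y t) := by
    intro s t
    by_cases hst : meet (x s) (x t) = ⊤
    · rw [hst, (htop s t).1 hst, map_top]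
    · have := congrArg (WithTop.some) (hσ ⟨(s, t), hst⟩)
      rw [WithTop.coe_untop] at this
      rw [← this]
      conv_lhs => rw [← WithTop.coe_untop _ hst]
      rfl
  let τ : Equiv.Perm MClev := Finsupp.equivCongrLeft σ.toEquiv
  have hτ : ∀ a b, meet (τ a) (τ b) = σ.withTopCongr (meet a b) := meet_equivMapDomain σ
  obtain ⟨g, hg, hgx⟩ := exists_perm_of_meet_eq (fun t => τ (x t)) y fun s t => by rw [hτ, hm]
  exact ⟨τ.trans g, isAut_of_strictMono (τ.trans g).bijective σ.withTopCongr.strictMono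
    fun a b => (hg _ _).trans (hτ a b), hgx⟩

/-- `Aut(M_{C,lev})` is oligomorphic: for every `n ≥ 1` the
diagonal action of the automorphism group of `(M, C, V)` on `Mⁿ` has only
finitely many orbits, i.e. there are finitely many tuples such that every
`n`-tuple is the image of one of them under an automorphism. -/
theorem aut_oligomorphic (n : ℕ) (hn : 1 ≤ n) :
    ∃ (N : ℕ) (reps : Fin N → (Fin n → MClev)),
      ∀ x : Fin n → MClev, ∃ (i : Fin N) (g : MClev → MClev),
        IsAut g ∧ ∀ t : Fin n, g (reps i t) = x t := by
  classical
  let P := Set.range (meetPattern : (Fin n → MClev) → Set ((Fin n × Fin n) × (Fin n × Fin n)))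
  have : Finite P := inferInstance
  obtain ⟨N, ⟨e⟩⟩ := Finite.exists_equiv_fin P
  refine ⟨N, fun i => (e.symm i).2.choose, fun x => ?_⟩
  refine ⟨e ⟨meetPattern x, x, rfl⟩, exists_isAut_of_meetPattern_eq ?_⟩
  exact (e.symm (e ⟨meetPattern x, x, rfl⟩)).2.choose_spec.trans (by rw [Equiv.symm_apply_apply])
end
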